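/- arXiv:0810.5684 — 2 statements merged into one kernel-verified Lean document; each statement's English description precedes it below -/
import Mathlib

section
/- If R is an artin algebra, then the homotopy category K(Mod-R) is well generated if and only if R is of finite representation type (i.e., there are only finitely many isomorphism classes of finitely generated indecomposable right R-modules). -/
namespace LocWellGen

open CategoryTheory CategoryTheory.Limits CategoryTheory.Pretriangulated ZeroObject

universe v u

variable (T : Type u) [Category.{v} T] [HasZeroObject T] [HasShift T ℤ]
  [Preadditive T] [∀ n : ℤ, (shiftFunctor T n).Additive] [Pretriangulated T]

/-- A localizing subcategory of a pretriangulated category, given as a class of objects: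
a full triangulated subcategory closed under isomorphisms and (existing) coproducts. -/
structure IsLocalizing (L : Set T) : Prop where
  zero : (0 : T) ∈ L
  isoClosed : ∀ {X Y : T}, (X ≅ Y) → X ∈ L → Y ∈ L
  shiftClosed : ∀ (X : T) (n : ℤ), X ∈ L → X⟦n⟧ ∈ L
  ext₂ : ∀ D ∈ distTriang T, D.obj₁ ∈ L → D.obj₃ ∈ L → D.obj₂ ∈ L
  coproductClosed : ∀ {I : Type v} (X : I → T), (∀ i, X i ∈ L) →
    ∀ (c : Cofan X), IsColimit c → c.pt ∈ L

/-- `Loc S` : the smallest localizing subcategory containing `S`. -/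
def Loc (S : Set T) : Set T := ⋂₀ {L : Set T | IsLocalizing T L ∧ S ⊆ L}

/-- `Y` is `κ`-small: any morphism from `Y` to a coproduct (of objects of `L`) factors
through a subcoproduct with fewer than `κ` summands. -/
def IsKappaSmall (L : Set T) (κ : Cardinal.{v}) (Y : T) : Prop :=
  ∀ {I : Type v} (X : I → T), (∀ i, X i ∈ L) →
    ∀ (c : Cofan X), IsColimit c → ∀ f : Y ⟶ c.pt,
      ∃ (J : Set I) (c' : Cofan fun j : J => X j) (hc' : IsColimit c') (g : Y ⟶ c'.pt),
        Cardinal.mk J < κ ∧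
        f = g ≫ hc'.desc (Cofan.mk c.pt fun j : J => c.inj j.1)

/-- Condition (3) of well generation: every morphism from `Y` to a coproduct of a family
in `L` factors through a coproduct of objects of `S` via a coproduct of morphisms. -/
def FactorsThroughFamily (L S : Set T) (Y : T) : Prop :=
  ∀ {I : Type v} (X : I → T), (∀ i, X i ∈ L) →
    ∀ (c : Cofan X), IsColimit c → ∀ f : Y ⟶ c.pt,
      ∃ (Z : I → T) (_ : ∀ i, Z i ∈ S) (φ : ∀ i, Z i ⟶ X i)
        (cz : Cofan Z) (hcz : IsColimit cz) (g : Y ⟶ cz.pt),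
        f = g ≫ hcz.desc (Cofan.mk c.pt fun i => φ i ≫ c.inj i)

/-- The set `S` witnesses that the (localizing sub)category `L` is `κ`-well generated. -/
structure GeneratesWell (L : Set T) (κ : Cardinal.{v}) (S : Set T) : Prop where
  subset : S ⊆ L
  isSmall : Small.{v} ↥S
  nondegenerate : ∀ X ∈ L, (∀ Y ∈ S, ∀ f : Y ⟶ X, f = 0) → IsZero X
  kappaSmall : ∀ Y ∈ S, IsKappaSmall T L κ Y
  factors : ∀ Y ∈ S, FactorsThroughFamily T L S Y

/-- `L` is a `κ`-well generated (localizing sub)category. -/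
def IsWellGeneratedOfCard (L : Set T) (κ : Cardinal.{v}) : Prop :=
  κ.IsRegular ∧ ∃ S : Set T, GeneratesWell T L κ S

/-- `L` is a well generated (localizing sub)category. -/
def IsWellGeneratedSubcat (L : Set T) : Prop :=
  ∃ κ : Cardinal.{v}, IsWellGeneratedOfCard T L κ

/-- compactly generated = `ℵ₀`-well generated -/
def IsCompactlyGeneratedSubcat (L : Set T) : Prop :=
  IsWellGeneratedOfCard T L Cardinal.aleph0

/-- The whole category `T` is well generated. -/
abbrev IsWellGenerated : Prop := IsWellGeneratedSubcat T Set.univ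

/-- A localizing subcategory `L` is locally well generated if the localizing subcategory
generated by any set of its objects is well generated. -/
def IsLocallyWellGeneratedSubcat (L : Set T) : Prop :=
  ∀ S : Set T, S ⊆ L → Small.{v} ↥S → IsWellGeneratedSubcat T (Loc T S)

/-- `T` is locally well generated. -/
abbrev IsLocallyWellGenerated : Prop := IsLocallyWellGeneratedSubcat T Set.univ

/-- `Y` is a retract (direct summand) of `X`. -/
def IsRetractOf {B : Type*} [Category B] (Y X : B) : Prop :=
  ∃ (s : Y ⟶ X) (r : X ⟶ Y), s ≫ r = 𝟙 Y

end LocWellGen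

namespace LocWellGen

open CategoryTheory CategoryTheory.Limits

universe v u
/-- An additive category with arbitrary coproducts is pure semisimple if it has an
additive generator: `B = Add X` for some `X`, i.e. every object is a direct summand
of a coproduct of copies of `X`. -/
def IsPureSemisimple (B : Type u) [Category.{v} B] : Prop :=
  ∃ X : B, ∀ Y : B, ∃ (I : Type v) (c : Cofan fun _ : I => X) (_ : IsColimit c),
    IsRetractOf Y c.pt

end LocWellGen

namespace LocWellGen

open CategoryTheory CategoryTheory.Limits

universe u

/-- A module is indecomposable: it is nonzero and admits no nontrivial idempotent
endomorphism (equivalently, it is not a direct sum of two nonzero submodules). -/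
def IsIndecomposableModule (R : Type u) [Ring R] (M : Type u) [AddCommGroup M]
    [Module R M] : Prop :=
  (∃ x : M, x ≠ 0) ∧ ∀ e : M →ₗ[R] M, e.comp e = e → e = 0 ∨ e = LinearMap.id

/-- `R` has finite representation type: up to isomorphism, there are only finitely many
finitely generated indecomposable right `R`-modules. -/
def HasFiniteRepresentationType (R : Type u) [Ring R] : Prop :=
  ∃ (n : ℕ) (M : Fin n → ModuleCat.{u} Rᵐᵒᵖ),
    ∀ N : ModuleCat.{u} Rᵐᵒᵖ, Module.Finite Rᵐᵒᵖ N → IsIndecomposableModule Rᵐᵒᵖ N →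
      ∃ i, Nonempty (N ≅ M i)

end LocWellGen

namespace LocWellGen

universe u

section Matlis

variable {k : Type u} [CommRing k]

/-- `E` is an essential extension of `W`: nonzero elements of `E` have nonzero multiples in `W`. -/
def IsEssentialOver {I : Type u} [AddCommGroup I] [Module k I] (W E : Submodule k I) : Prop :=
  ∀ x ∈ E, x ≠ 0 → ∃ a : k, a • x ∈ W ∧ a • x ≠ 0

theorem exists_injective_isEssentialOver {I : Type u} [AddCommGroup I] [Module k I]
    [Module.Injective k I] (W : Submodule k I) :
    ∃ E : Submodule k I, W ≤ E ∧ IsEssentialOver W E ∧ Module.Injective k E := by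
  obtain ⟨E, hWE, hE⟩ := zorn_le_nonempty₀ {E : Submodule k I | W ≤ E ∧ IsEssentialOver W E}
    (fun c hc hchain y hy => by
      refine ⟨sSup c, ⟨(hc hy).1.trans (le_sSup hy), fun x hx hx0 => ?_⟩,
        fun z hz => le_sSup hz⟩
      obtain ⟨z, hz, hxz⟩ := (Submodule.mem_sSup_of_directed ⟨y, hy⟩ hchain.directedOn).1 hx
      exact (hc hz).2 x hxz hx0) W ⟨le_rfl, fun x hx hx0 => ⟨1, by simpa using ⟨hx, hx0⟩⟩⟩
  obtain ⟨C, -, hC⟩ := zorn_le_nonempty₀ {C : Submodule k I | Disjoint E C}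
    (fun c hc hchain y hy => by
      refine ⟨sSup c, ?_, fun z hz => le_sSup hz⟩
      refine Submodule.disjoint_def.2 fun x hxE hx => ?_
      obtain ⟨z, hz, hxz⟩ := (Submodule.mem_sSup_of_directed ⟨y, hy⟩ hchain.directedOn).1 hx
      exact Submodule.disjoint_def.1 (hc hz) x hxE hxz) ⊥ disjoint_bot_right
  have key : ∀ x : I, x ∉ C → ∃ (a : k) (e : I), e ∈ E ∧ e ≠ 0 ∧ e - a • x ∈ C := by
    intro x hx
    by_contra! hcon
    refine hx (hC.2 (y := C ⊔ Submodule.span k {x}) ?_ le_sup_left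
      (le_sup_right (a := C) (Submodule.mem_span_singleton_self x)))
    refine Submodule.disjoint_def.2 fun e heE he => ?_
    obtain ⟨c, hc, y, hy, rfl⟩ := Submodule.mem_sup.1 he
    obtain ⟨a, rfl⟩ := Submodule.mem_span_singleton.1 hy
    by_contra h0
    exact hcon a _ heE h0 (by simpa using hc)
  have hj : Function.Injective (C.mkQ.comp E.subtype) := by
    rw [← LinearMap.ker_eq_bot, LinearMap.ker_eq_bot']
    intro e he
    have : (e : I) ∈ C := by simpa using he
    exact Subtype.ext (Submodule.disjoint_def.1 hC.1 e e.2 this)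
  obtain ⟨g, hg⟩ := Module.Injective.out (R := k) (Q := I) (C.mkQ.comp E.subtype) hj E.subtype
  have hmk : ∀ (x e : I) (a : k), e ∈ E → e - a • x ∈ C → a • g (C.mkQ x) = e := by
    intro x e a he hx
    have h1 : C.mkQ e = C.mkQ (a • x) := (Submodule.Quotient.eq C).2 hx
    rw [← map_smul, ← map_smul, ← h1]
    exact hg ⟨e, he⟩
  have hEg : E ≤ LinearMap.range g := fun e he => ⟨C.mkQ e, hg ⟨e, he⟩⟩
  have hgE : LinearMap.range g ≤ E := by
    refine hE.2 (y := LinearMap.range g) ⟨hWE.trans hEg, ?_⟩ hEg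
    rintro _ ⟨y, rfl⟩ hy0
    obtain ⟨x, rfl⟩ := C.mkQ_surjective y
    have hx : x ∉ C := fun hx => hy0 (by
      have : C.mkQ x = 0 := by simpa using hx
      rw [this, map_zero])
    obtain ⟨a, e, he, he0, hea⟩ := key x hx
    obtain ⟨b, hb, hb0⟩ := hE.1.2 e he he0
    refine ⟨b * a, ?_⟩
    rw [mul_smul, hmk x e a he hea]
    exact ⟨hb, hb0⟩
  refine ⟨E, hWE, hE.1.2, ⟨fun X Y _ _ _ _ f hf h => ?_⟩⟩
  obtain ⟨h', hh'⟩ := Module.Injective.out (R := k) (Q := I) f hf (E.subtype.comp h)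
  refine ⟨(g.codRestrict E fun x => hgE ⟨x, rfl⟩).comp (C.mkQ.comp h'), fun x => ?_⟩
  apply Subtype.ext
  simp only [LinearMap.comp_apply, LinearMap.codRestrict_apply, hh']
  exact hg (h x)

/-- Over a commutative ring there is an injective module `E` containing each simple module exactly
once. -/
theorem exists_injective_simple_hom (k : Type u) [CommRing k] :
    ∃ (E : Type u) (_ : AddCommGroup E) (_ : Module k E), Module.Injective k E ∧
      (∀ m : Ideal k, m.IsMaximal → ∃ x : E, x ≠ 0 ∧ ∀ a ∈ m, a • x = 0) ∧
      ∀ (V : Type u) [AddCommGroup V] [Module k V] [IsSimpleModule k V] (φ ψ : V →ₗ[k] E),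
        φ ≠ 0 → ∃ a : k, ψ = a • φ := by
  let W₀ := ∀ m : MaximalSpectrum k, k ⧸ m.asIdeal
  obtain ⟨I, _, _, hI, ι, hι⟩ : ∃ (I : Type u) (_ : AddCommGroup I) (_ : Module k I)
      (_ : Module.Injective k I) (ι : W₀ →ₗ[k] I), Function.Injective ι := by
    let J := CategoryTheory.Injective.under (ModuleCat.of k W₀)
    refine ⟨J, inferInstance, inferInstance, ?_,
      (CategoryTheory.Injective.ι (ModuleCat.of k W₀)).hom, ?_⟩
    · have : CategoryTheory.Injective (ModuleCat.of k J) :=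
        inferInstanceAs (CategoryTheory.Injective J)
      exact Module.injective_module_of_injective_object k J
    · exact (ModuleCat.mono_iff_injective _).1 inferInstance
  obtain ⟨E, hWE, hess, hE⟩ := exists_injective_isEssentialOver (LinearMap.range ι)
  have hann : ∀ (m : MaximalSpectrum k) (x : W₀), (∀ a ∈ m.asIdeal, a • x = 0) →
      ∀ m' ≠ m, x m' = 0 := by
    intro m x hx m' hm'
    have hsup : m.asIdeal ⊔ m'.asIdeal = ⊤ :=
      m.isMaximal.coprime_of_ne m'.isMaximal fun h => hm' (MaximalSpectrum.ext h.symm)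
    obtain ⟨a, ha, b, hb, hab⟩ := Submodule.mem_sup.1 (hsup ▸ Submodule.mem_top : (1 : k) ∈ _)
    have h1 : a • x m' = 0 := congrFun (hx a ha) m'
    have h2 : b • x m' = 0 := by
      obtain ⟨y, hy⟩ := Ideal.Quotient.mk_surjective (x m')
      rw [← hy]
      exact Ideal.Quotient.eq_zero_iff_mem.2 (Ideal.mul_mem_right _ _ hb)
    rw [← one_smul k (x m'), ← hab, add_smul, h1, h2, add_zero]
  have hdim : ∀ (m : MaximalSpectrum k) (x y : W₀), (∀ a ∈ m.asIdeal, a • x = 0) →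
      (∀ a ∈ m.asIdeal, a • y = 0) → x ≠ 0 → ∃ a : k, y = a • x := by
    intro m x y hx hy hx0
    have hxm : x m ≠ 0 := fun h => hx0 (funext fun m' => by
      by_cases hm : m' = m
      · rw [hm, h]; rfl
      · exact hann m x hx m' hm)
    have := m.isMaximal
    let _ := Ideal.Quotient.field m.asIdeal
    obtain ⟨a, ha⟩ := Ideal.Quotient.mk_surjective (y m * (x m)⁻¹)
    refine ⟨a, funext fun m' => ?_⟩
    by_cases hm : m' = m
    · subst hm
      change y m' = Ideal.Quotient.mk _ a * x m'
      rw [ha, mul_assoc, inv_mul_cancel₀ hxm, mul_one]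
    · change y m' = a • x m'
      rw [hann m x hx m' hm, hann m y hy m' hm, smul_zero]
  refine ⟨E, inferInstance, inferInstance, hE, fun m hm => ?_, ?_⟩
  · classical
    let w : W₀ := Pi.single ⟨m, hm⟩ 1
    refine ⟨⟨ι w, hWE ⟨w, rfl⟩⟩, fun h => ?_, fun a ha => ?_⟩
    · have h1 : w = 0 := hι (by simpa using congrArg Subtype.val h)
      have h2 : w ⟨m, hm⟩ = 0 := congrFun h1 _
      rw [show w ⟨m, hm⟩ = 1 from Pi.single_eq_same _ _] at h2
      exact hm.ne_top ((Ideal.eq_top_iff_one _).2 (Ideal.Quotient.eq_zero_iff_mem.1 h2))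
    · have h1 : a • w = 0 := by
        have : a • w = Pi.single ⟨m, hm⟩ (a • 1) := (Pi.single_smul _ _ _).symm
        rw [this, show a • (1 : k ⧸ m) = 0 from ?_, Pi.single_zero]
        rw [← map_one (Ideal.Quotient.mk m)]
        exact Ideal.Quotient.eq_zero_iff_mem.2 (Ideal.mul_mem_right _ _ ha)
      apply Subtype.ext
      change a • ι w = 0
      rw [← map_smul, h1, map_zero]
  · intro V _ _ _ φ ψ hφ
    by_cases hψ : ψ = 0
    · exact ⟨0, by simp [hψ]⟩
    have hgen : ∀ χ : V →ₗ[k] E, χ ≠ 0 → ∃ v : V, v ≠ 0 ∧ ((χ v : E) : I) ∈ LinearMap.range ι := by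
      intro χ hχ
      obtain ⟨v, hv⟩ : ∃ v, χ v ≠ 0 := by
        by_contra! h; exact hχ (LinearMap.ext h)
      obtain ⟨a, ha, ha0⟩ := hess (χ v) (χ v).2 (by simpa using hv)
      refine ⟨a • v, fun h => ha0 ?_, by simpa using ha⟩
      have := congrArg (fun x => ((χ x : E) : I)) h
      simpa using this
    have hspan : ∀ v : V, v ≠ 0 → ∀ w, ∃ a : k, a • v = w := fun v hv w =>
      IsSimpleModule.toSpanSingleton_surjective k hv w
    have hinj : Function.Injective φ := (LinearMap.injective_or_eq_zero φ).resolve_right hφ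
    obtain ⟨v, hv0, w, hw⟩ := hgen φ hφ
    obtain ⟨v', hv'0, w', hw'⟩ := hgen ψ hψ
    obtain ⟨c, rfl⟩ := hspan v' hv'0 v
    let m : MaximalSpectrum k := ⟨LinearMap.ker (LinearMap.toSpanSingleton k V (c • v')),
      IsSimpleModule.ker_toSpanSingleton_isMaximal k hv0⟩
    have hm : ∀ a ∈ m.asIdeal, a • (c • v') = 0 := fun a ha => by simpa [m] using ha
    have hmw : ∀ a ∈ m.asIdeal, a • w = 0 := fun a ha => hι (by
      rw [map_smul, hw, map_zero]
      have := congrArg (fun x => ((φ x : E) : I)) (hm a ha)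
      simpa only [map_smul, map_zero, Submodule.coe_smul, Submodule.coe_zero] using this)
    have hmw' : ∀ a ∈ m.asIdeal, a • (c • w') = 0 := fun a ha => hι (by
      rw [map_smul, map_smul, hw', map_zero]
      have := congrArg (fun x => ((ψ x : E) : I)) (hm a ha)
      simpa only [map_smul, map_zero, Submodule.coe_smul, Submodule.coe_zero] using this)
    have hw0 : w ≠ 0 := by
      rintro rfl
      exact hv0 (hinj (Subtype.ext (by rw [← hw]; simp)))
    obtain ⟨a, ha⟩ := hdim m w (c • w') hmw hmw' hw0
    refine ⟨a, LinearMap.ext fun x => ?_⟩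
    obtain ⟨b, rfl⟩ := hspan _ hv0 x
    suffices h : ψ (c • v') = (a • φ) (c • v') by
      rw [ψ.map_smul b, (a • φ).map_smul b, h]
    apply Subtype.ext
    have h1 := congrArg ι ha
    rw [map_smul, map_smul, hw, hw'] at h1
    rw [ψ.map_smul c]
    exact h1

end Matlis

section Dual

theorem length_hom_le {k : Type u} [CommRing k] {E : Type u} [AddCommGroup E] [Module k E]
    (hE : ∀ (V : Type u) [AddCommGroup V] [Module k V] [IsSimpleModule k V] (φ ψ : V →ₗ[k] E),
        φ ≠ 0 → ∃ a : k, ψ = a • φ)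
    {V : Type u} [AddCommGroup V] [Module k V] (hV : IsFiniteLength k V) :
    Module.length k (V →ₗ[k] E) ≤ Module.length k V := by
  induction hV with
  | of_subsingleton => simp [Module.length_eq_zero]
  | @of_simple_quotient M _ _ N hs _ ih =>
    have h1 : Module.length k ((M ⧸ N) →ₗ[k] E) ≤ 1 := by
      cases subsingleton_or_nontrivial ((M ⧸ N) →ₗ[k] E) with
      | inl h => simp [Module.length_eq_zero]
      | inr h =>
        refine (Module.length_eq_one_iff.2 (isSimpleModule_iff_toSpanSingleton_surjective.2
          ⟨h, fun φ hφ ψ => ?_⟩)).le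
        obtain ⟨a, ha⟩ := hE (M ⧸ N) φ ψ hφ
        exact ⟨a, by simp [ha]⟩
    let f : ((M ⧸ N) →ₗ[k] E) →ₗ[k] (M →ₗ[k] E) := LinearMap.lcomp k E N.mkQ
    let g : (M →ₗ[k] E) →ₗ[k] (N →ₗ[k] E) := LinearMap.lcomp k E N.subtype
    have hf : Function.Injective f := fun x y h =>
      LinearMap.cancel_right N.mkQ_surjective |>.1 h
    have hex : Function.Exact f g.rangeRestrict := by
      intro φ
      constructor
      · intro h
        have h2 : φ.comp N.subtype = 0 := congrArg Subtype.val h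
        refine ⟨N.liftQ φ fun x hx => LinearMap.congr_fun h2 ⟨x, hx⟩, ?_⟩
        exact LinearMap.ext fun x => rfl
      · rintro ⟨ψ, rfl⟩
        apply Subtype.ext
        refine LinearMap.ext fun x => ?_
        change ψ (N.mkQ x) = 0
        rw [Submodule.mkQ_apply, (Submodule.Quotient.mk_eq_zero N).2 x.2, map_zero]
    rw [Module.length_eq_add_of_exact f g.rangeRestrict hf g.surjective_rangeRestrict hex,
      Module.length_eq_add_of_exact N.subtype N.mkQ N.subtype_injective N.mkQ_surjective
        (LinearMap.exact_subtype_mkQ N), add_comm,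
      Module.length_eq_one k (M ⧸ N)]
    exact add_le_add ((Module.length_le_of_injective _ g.range.subtype_injective).trans ih) h1

/-- Matlis duality over a commutative artinian ring. -/
theorem exists_dualizing_module (k : Type u) [CommRing k] [IsArtinianRing k] :
    ∃ (E : Type u) (_ : AddCommGroup E) (_ : Module k E), Module.Injective k E ∧
      ∀ (V : Type u) [AddCommGroup V] [Module k V] [Module.Finite k V],
        Module.Finite k (V →ₗ[k] E) ∧ (∀ v : V, (∀ φ : V →ₗ[k] E, φ v = 0) → v = 0) ∧
        ∀ ψ : (V →ₗ[k] E) →ₗ[k] E, ∃ v, ∀ φ, φ v = ψ φ := by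
  obtain ⟨E, _, _, hinj, hsoc, hsimple⟩ := exists_injective_simple_hom k
  refine ⟨E, inferInstance, inferInstance, hinj, fun V _ _ _ => ?_⟩
  have hsep : ∀ v : V, (∀ φ : V →ₗ[k] E, φ v = 0) → v = 0 := by
    intro v hv
    by_contra hv0
    have hann : LinearMap.ker (LinearMap.toSpanSingleton k V v) ≠ ⊤ := fun h => hv0 (by
      have : (1 : k) ∈ LinearMap.ker (LinearMap.toSpanSingleton k V v) := h ▸ Submodule.mem_top
      simpa using this)
    obtain ⟨m, hm, hle⟩ := Ideal.exists_le_maximal _ hann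
    obtain ⟨x, hx0, hx⟩ := hsoc m hm
    let f : (k ⧸ LinearMap.ker (LinearMap.toSpanSingleton k V v)) →ₗ[k] V :=
      Submodule.liftQ _ (LinearMap.toSpanSingleton k V v) le_rfl
    let g : (k ⧸ LinearMap.ker (LinearMap.toSpanSingleton k V v)) →ₗ[k] E :=
      Submodule.liftQ _ (LinearMap.toSpanSingleton k E x) fun a ha => by
        simpa using hx a (hle ha)
    obtain ⟨φ, hφ⟩ := hinj.out f
      (LinearMap.ker_eq_bot.1 (Submodule.ker_liftQ_eq_bot _ _ _ le_rfl)) g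
    have h1 := hφ (Submodule.Quotient.mk 1)
    simp only [f, g, Submodule.liftQ_apply, LinearMap.toSpanSingleton_apply, one_smul] at h1
    exact hx0 (h1 ▸ hv φ)
  have hVl : IsFiniteLength k V := isFiniteLength_iff_isNoetherian_isArtinian.2
    ⟨inferInstance, inferInstance⟩
  have hl1 := length_hom_le hsimple hVl
  have hDl : IsFiniteLength k (V →ₗ[k] E) := Module.length_ne_top_iff.1
    (ne_top_of_le_ne_top (Module.length_ne_top_iff.2 hVl) hl1)
  have hl2 := length_hom_le hsimple hDl
  have hDDl : IsFiniteLength k ((V →ₗ[k] E) →ₗ[k] E) := Module.length_ne_top_iff.1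
    (ne_top_of_le_ne_top (Module.length_ne_top_iff.2 hDl) hl2)
  obtain ⟨_, _⟩ := isFiniteLength_iff_isNoetherian_isArtinian.1 hDl
  obtain ⟨_, _⟩ := isFiniteLength_iff_isNoetherian_isArtinian.1 hDDl
  refine ⟨inferInstance, hsep, ?_⟩
  let ev : V →ₗ[k] ((V →ₗ[k] E) →ₗ[k] E) := LinearMap.applyₗ
  have hev : Function.Injective ev := by
    rw [← LinearMap.ker_eq_bot, LinearMap.ker_eq_bot']
    exact fun v hv => hsep v fun φ => LinearMap.congr_fun hv φ
  have hrange : LinearMap.range ev = ⊤ := by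
    by_contra h
    have h1 := Submodule.length_lt h
    rw [← (LinearEquiv.ofInjective ev hev).length_eq] at h1
    exact absurd (hl2.trans hl1) (not_le.2 h1)
  intro ψ
  obtain ⟨v, hv⟩ := LinearMap.range_eq_top.1 hrange ψ
  exact ⟨v, fun φ => LinearMap.congr_fun hv φ⟩

end Dual

section AlmostSplit

theorem IsIndecomposableModule.isUnit_or_isNilpotent {A : Type u} [Ring A] {L : Type u}
    [AddCommGroup L] [Module A L] [IsNoetherian A L] [IsArtinian A L]
    (hL : IsIndecomposableModule A L) (f : Module.End A L) : IsUnit f ∨ IsNilpotent f := by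
  obtain ⟨n, hn⟩ := (f.eventually_isCompl_ker_pow_range_pow.and
    (Filter.eventually_ge_atTop 1)).exists
  obtain ⟨hc, hn1⟩ := hn
  have hid := Submodule.isIdempotentElem_projection hc
  rcases hL.2 _ hid with h | h
  · left
    have hk : LinearMap.ker (f ^ n) = ⊥ := by
      rw [← Submodule.range_projection hc, h, LinearMap.range_zero]
    have hr : LinearMap.range (f ^ n) = ⊤ := by
      rw [← Submodule.ker_projection hc, h, LinearMap.ker_zero]
    refine (isUnit_pow_iff (by omega : n ≠ 0)).1 ((Module.End.isUnit_iff _).2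
      ⟨LinearMap.ker_eq_bot.1 hk, LinearMap.range_eq_top.1 hr⟩)
  · right
    refine ⟨n, LinearMap.ker_eq_top.1 ?_⟩
    rw [← Submodule.range_projection hc, h, LinearMap.range_id]

/-- Local endomorphism rings: if a sum of two compositions through `L` is the identity, then one of
the first maps is a split monomorphism. -/
theorem IsIndecomposableModule.split_of_add {A : Type u} [Ring A] {L : Type u}
    [AddCommGroup L] [Module A L] [IsNoetherian A L] [IsArtinian A L]
    (hL : IsIndecomposableModule A L) {N N' : Type u} [AddCommGroup N] [Module A N]
    [AddCommGroup N'] [Module A N'] (g : L →ₗ[A] N) (g' : L →ₗ[A] N') (r : N →ₗ[A] L)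
    (r' : N' →ₗ[A] L) (h : r ∘ₗ g + r' ∘ₗ g' = LinearMap.id) :
    (∃ s : N →ₗ[A] L, s ∘ₗ g = LinearMap.id) ∨ ∃ s : N' →ₗ[A] L, s ∘ₗ g' = LinearMap.id := by
  have key : ∀ {N : Type u} [AddCommGroup N] [Module A N] (g : L →ₗ[A] N) (r : N →ₗ[A] L),
      IsUnit (M := Module.End A L) (r ∘ₗ g) → ∃ s : N →ₗ[A] L, s ∘ₗ g = LinearMap.id := by
    intro N _ _ g r hu
    obtain ⟨v, hv⟩ := hu.exists_left_inv
    exact ⟨v ∘ₗ r, hv⟩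
  rcases hL.isUnit_or_isNilpotent (r ∘ₗ g) with hu | hn
  · exact Or.inl (key g r hu)
  · refine Or.inr (key g' r' ?_)
    have : (r' ∘ₗ g' : Module.End A L) = 1 - r ∘ₗ g := by
      rw [eq_sub_iff_add_eq']; exact h
    rw [this]
    exact hn.isUnit_one_sub

theorem exists_extend_of_ker_le {k : Type u} [CommRing k] {E : Type u} [AddCommGroup E]
    [Module k E] (hE : Module.Injective k E) {X Y : Type u} [AddCommGroup X] [Module k X]
    [AddCommGroup Y] [Module k Y] (f : X →ₗ[k] Y) (h : X →ₗ[k] E)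
    (hk : LinearMap.ker f ≤ LinearMap.ker h) : ∃ h' : Y →ₗ[k] E, ∀ x, h' (f x) = h x := by
  obtain ⟨h', hh'⟩ := hE.out ((LinearMap.ker f).liftQ f le_rfl)
    (LinearMap.ker_eq_bot.1 (Submodule.ker_liftQ_eq_bot _ _ _ le_rfl))
    ((LinearMap.ker f).liftQ h hk)
  exact ⟨h', fun x => hh' (Submodule.Quotient.mk x)⟩

variable {k : Type u} [CommRing k] {A : Type u} [Ring A] [Algebra k A]

/-- The tuples in `L ^ q` whose image under `g` is given by the matrix `w` with coefficients in
`A`. -/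
def matrixPreimage {L : Type u} [AddCommGroup L] [Module A L] [Module k L] [IsScalarTower k A L]
    {p q : ℕ} (w : Fin p → Fin q → A) {N : Type u} [AddCommGroup N] [Module A N] [Module k N]
    [IsScalarTower k A N] (g : L →ₗ[A] N) : Submodule k (Fin q → L) where
  carrier := {x | ∃ z : Fin p → N, ∀ j, g (x j) = ∑ i, w i j • z i}
  add_mem' := by
    rintro x y ⟨z, hz⟩ ⟨z', hz'⟩
    exact ⟨z + z', fun j => by simp [hz, hz', Finset.sum_add_distrib]⟩
  zero_mem' := ⟨0, fun j => by simp⟩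
  smul_mem' := by
    rintro c x ⟨z, hz⟩
    refine ⟨c • z, fun j => ?_⟩
    have : SMulCommClass k A N := IsScalarTower.to_smulCommClass
    simp only [Pi.smul_apply, smul_comm _ c, ← Finset.smul_sum, ← hz]
    rw [← algebraMap_smul A c (x j), map_smul, algebraMap_smul]

theorem exists_matrix_detecting_split [IsArtinianRing k] [Module.Finite k A]
    {L : Type u} [AddCommGroup L] [Module A L] [Module k L] [IsScalarTower k A L]
    [Module.Finite k L] :
    ∃ (p q : ℕ) (w : Fin p → Fin q → A) (E : Type u) (_ : AddCommGroup E) (_ : Module k E)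
      (ev : (Fin q → L) →ₗ[k] E), (∀ z : Fin p → L, ev (fun j => ∑ i, w i j • z i) = 0) ∧
      ∀ (N : Type u) [AddCommGroup N] [Module A N] [Module k N] [IsScalarTower k A N]
        (g : L →ₗ[A] N), matrixPreimage w g ≤ LinearMap.ker ev →
          ∃ s : N →ₗ[A] L, s ∘ₗ g = LinearMap.id := by
  classical
  obtain ⟨E, _, _, hE, hdual⟩ := exists_dualizing_module k
  obtain ⟨hfin, hsep, hrefl⟩ := hdual L
  obtain ⟨q, e, he⟩ := Module.Finite.exists_fin (R := k) (M := L →ₗ[k] E)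
  let W : Submodule k (Fin q → A) :=
    { carrier := {w | ∀ x : L, ∑ j, e j (w j • x) = 0}
      add_mem' := fun {a b} ha hb x => by
        simp [add_smul, Finset.sum_add_distrib, ha x, hb x]
      zero_mem' := fun x => by simp
      smul_mem' := fun c w hw x => by
        simp [smul_assoc, ← Finset.smul_sum, hw x] }
  obtain ⟨p, w, hw⟩ := Module.Finite.exists_fin (R := k) (M := W)
  let ev : (Fin q → L) →ₗ[k] E := ∑ j, (e j).comp (LinearMap.proj j)
  have hev : ∀ x, ev x = ∑ j, e j (x j) := fun x => by simp [ev]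
  refine ⟨p, q, fun i => (w i : Fin q → A), E, inferInstance, inferInstance, ev, fun z => ?_, ?_⟩
  · rw [hev]
    simp only [map_sum]
    rw [Finset.sum_comm]
    exact Finset.sum_eq_zero fun i _ => (w i).2 (z i)
  · intro N _ _ _ _ g hle
    have hcomm : SMulCommClass k A N := IsScalarTower.to_smulCommClass
    let θ : (Fin p → N) →ₗ[k] (Fin q → N) :=
      { toFun := fun z j => ∑ i, (w i : Fin q → A) j • z i
        map_add' := fun z z' => by ext j; simp [Finset.sum_add_distrib]
        map_smul' := fun c z => by ext j; simp [smul_comm _ c, Finset.smul_sum] }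
    let gq : (Fin q → L) →ₗ[k] (Fin q → N) := (g.restrictScalars k).compLeft (Fin q)
    obtain ⟨φ, hφ⟩ := exists_extend_of_ker_le hE ((LinearMap.range θ).mkQ.comp gq) ev (by
      refine le_trans (fun x hx => ?_) hle
      have : gq x ∈ LinearMap.range θ := by simpa using hx
      obtain ⟨z, hz⟩ := this
      exact ⟨z, fun j => (congrFun hz j).symm⟩)
    let φj : Fin q → N →ₗ[k] E := fun j =>
      φ.comp ((LinearMap.range θ).mkQ.comp (LinearMap.single k (fun _ => N) j))
    have hφj : ∀ y : Fin q → N, ∑ j, φj j (y j) = φ ((LinearMap.range θ).mkQ y) := by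
      intro y
      conv_rhs => rw [← Finset.univ_sum_single y, map_sum, map_sum]
      rfl
    have hφg : ∀ j x, φj j (g x) = e j x := by
      intro j x
      have h1 := hφ (Pi.single j x)
      rw [hev, Finset.sum_eq_single j (fun i _ hi => by simp [hi]) (by simp)] at h1
      rw [Pi.single_eq_same] at h1
      rw [← h1]
      have h2 : gq (Pi.single j x) = Pi.single j (g x) := by
        ext i
        by_cases h : i = j
        · subst h; simp [gq]
        · simp [gq, h]
      change φ _ = φ ((LinearMap.range θ).mkQ (gq (Pi.single j x)))
      rw [h2]
      rfl
    have hW : ∀ v ∈ W, ∀ y : N, ∑ j, φj j (v j • y) = 0 := by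
      intro v hv y
      rw [hφj fun j => v j • y]
      have hmem : (⟨v, hv⟩ : W) ∈ Submodule.span k (Set.range w) := hw ▸ Submodule.mem_top
      obtain ⟨c, hc⟩ := (Submodule.mem_span_range_iff_exists_fun k).1 hmem
      have : (fun j => v j • y) = θ (fun i => c i • y) := by
        ext j
        have h1 : v j = ∑ i, c i • (w i : Fin q → A) j := by
          have := congrArg (fun x : W => (x : Fin q → A) j) hc
          simpa using this.symm
        simp only [h1, Finset.sum_smul]
        change _ = ∑ i, (w i : Fin q → A) j • (c i • y)
        exact Finset.sum_congr rfl fun i _ => by rw [smul_comm, smul_assoc]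
      rw [this]
      have : (LinearMap.range θ).mkQ (θ fun i => c i • y) = 0 := by simp
      rw [this, map_zero]
    have hspan : ∀ χ : L →ₗ[k] E, ∃ c : Fin q → k, χ = ∑ j, c j • e j := by
      intro χ
      obtain ⟨c, hc⟩ := (Submodule.mem_span_range_iff_exists_fun k).1
        (he ▸ Submodule.mem_top : χ ∈ Submodule.span k (Set.range e))
      exact ⟨c, hc.symm⟩
    have hsep' : ∀ x y : L, (∀ j, e j x = e j y) → x = y := by
      intro x y h
      refine sub_eq_zero.1 (hsep _ fun χ => ?_)
      obtain ⟨c, rfl⟩ := hspan χ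
      simp [h]
    have hex : ∀ y : N, ∃ x : L, ∀ j, e j x = φj j y := by
      intro y
      let T : (Fin q → k) →ₗ[k] E := ∑ j, (LinearMap.toSpanSingleton k E (φj j y)).comp
        (LinearMap.proj j)
      have hT : ∀ c, T c = ∑ j, c j • φj j y := fun c => by simp [T]
      obtain ⟨ψ, hψ⟩ := exists_extend_of_ker_le hE (Fintype.linearCombination k e) T (by
        intro c hc
        have hc' : ∑ j, c j • e j = 0 := by
          simpa [Fintype.linearCombination_apply] using hc
        rw [LinearMap.mem_ker, hT]
        have := hW (fun j => algebraMap k A (c j)) (fun x => by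
          have := LinearMap.congr_fun hc' x
          simpa using this) y
        simpa using this)
      obtain ⟨x, hx⟩ := hrefl ψ
      refine ⟨x, fun j => ?_⟩
      rw [hx]
      have h1 := hψ (Pi.single j 1)
      rw [hT, Finset.sum_eq_single j (fun i _ hi => by simp [hi]) (by simp)] at h1
      simpa using h1
    choose r hr using hex
    refine ⟨{ toFun := r, map_add' := fun y y' => hsep' _ _ fun j => by simp [hr],
              map_smul' := fun a y => hsep' _ _ fun j => ?_ }, LinearMap.ext fun x =>
                hsep' _ _ fun j => by simp [hr, hφg]⟩
    obtain ⟨c, hc⟩ := hspan ((e j).comp (Algebra.lsmul k k L a))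
    have hcx : ∀ x : L, e j (a • x) = ∑ l, c l • e l x := fun x => by
      have := LinearMap.congr_fun hc x
      simpa using this
    have h1 := hW (fun l => algebraMap k A (c l) - (Pi.single j a : Fin q → A) l) (fun x => by
      simp only [sub_smul, map_sub, Finset.sum_sub_distrib, algebraMap_smul, map_smul, ← hcx]
      rw [Finset.sum_eq_single j (fun i _ hi => by simp [hi]) (by simp)]
      simp) y
    simp only [sub_smul, map_sub, Finset.sum_sub_distrib, algebraMap_smul, map_smul] at h1
    rw [Finset.sum_eq_single (f := fun l => φj l ((Pi.single j a : Fin q → A) l • y)) j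
      (fun i _ hi => by simp [hi]) (by simp), Pi.single_eq_same, sub_eq_zero] at h1
    rw [hr, RingHom.id_apply, hcx, ← h1]
    simp [hr]

/-- `a` is a left almost split map. -/
def IsLeftAlmostSplit {L E : Type u} [AddCommGroup L] [Module A L] [AddCommGroup E] [Module A E]
    (a : L →ₗ[A] E) : Prop :=
  (¬ ∃ s : E →ₗ[A] L, s ∘ₗ a = LinearMap.id) ∧
    ∀ (N : Type u) [AddCommGroup N] [Module A N] (g : L →ₗ[A] N),
      (¬ ∃ s : N →ₗ[A] L, s ∘ₗ g = LinearMap.id) → ∃ g' : E →ₗ[A] N, g = g' ∘ₗ a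

theorem exists_isLeftAlmostSplit [IsArtinianRing k] [Module.Finite k A]
    {L : Type u} [AddCommGroup L] [Module A L] [Module.Finite A L]
    (hL : IsIndecomposableModule A L) :
    ∃ (E : Type u) (_ : AddCommGroup E) (_ : Module A E) (a : L →ₗ[A] E),
      Module.Finite A E ∧ IsLeftAlmostSplit a := by
  classical
  let _ : Module k L := Module.compHom L (algebraMap k A)
  have : IsScalarTower k A L := ⟨fun c a x => by
    rw [Algebra.smul_def, mul_smul]; rfl⟩
  have : Module.Finite k L := Module.Finite.trans A L
  have : IsArtinian A L := isArtinian_of_tower k inferInstance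
  have : IsNoetherian A L := isNoetherian_of_tower k inferInstance
  obtain ⟨p, q, w, E, _, _, ev, hev, hdet⟩ := exists_matrix_detecting_split (k := k) (A := A)
    (L := L)
  let S : Set (Submodule k (Fin q → L)) := {V | ∃ (N : Type u) (_ : AddCommGroup N)
    (_ : Module A N) (_ : Module k N) (_ : IsScalarTower k A N) (g : L →ₗ[A] N),
    (¬ ∃ s : N →ₗ[A] L, s ∘ₗ g = LinearMap.id) ∧ matrixPreimage w g = V}
  have hS : S.Nonempty := by
    refine ⟨_, L, inferInstance, inferInstance, inferInstance, inferInstance, 0, ?_, rfl⟩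
    rintro ⟨s, hs⟩
    obtain ⟨x, hx⟩ := hL.1
    exact hx (by simpa using (LinearMap.congr_fun hs x).symm)
  obtain ⟨V, ⟨N₀, _, _, _, _, g₀, hg₀, rfl⟩, hmin⟩ :=
    (wellFounded_lt (α := Submodule k (Fin q → L))).has_min S hS
  have hle : ∀ (N : Type u) [AddCommGroup N] [Module A N] [Module k N] [IsScalarTower k A N]
      (g : L →ₗ[A] N), (¬ ∃ s : N →ₗ[A] L, s ∘ₗ g = LinearMap.id) →
      matrixPreimage w g₀ ≤ matrixPreimage (k := k) w g := by
    intro N _ _ _ _ g hg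
    have h1 : matrixPreimage (k := k) w (g₀.prod g) ≤ matrixPreimage w g₀ := by
      rintro x ⟨z, hz⟩
      exact ⟨fun i => (z i).1, fun j => by simpa [Prod.fst_sum] using congrArg Prod.fst (hz j)⟩
    have h2 : matrixPreimage (k := k) w (g₀.prod g) ≤ matrixPreimage w g := by
      rintro x ⟨z, hz⟩
      exact ⟨fun i => (z i).2, fun j => by simpa [Prod.snd_sum] using congrArg Prod.snd (hz j)⟩
    have h3 : matrixPreimage (k := k) w (g₀.prod g) ∈ S := by
      refine ⟨N₀ × N, inferInstance, inferInstance, inferInstance, inferInstance, _, ?_, rfl⟩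
      rintro ⟨s, hs⟩
      rcases hL.split_of_add g₀ g (s ∘ₗ LinearMap.inl A N₀ N) (s ∘ₗ LinearMap.inr A N₀ N) (by
        rw [← hs]
        refine LinearMap.ext fun x => ?_
        simp [← map_add]) with h | h
      · exact hg₀ h
      · exact hg h
    rw [← eq_of_le_of_not_lt h1 (hmin _ h3)]
    exact h2
  obtain ⟨x, hx, hx0⟩ := SetLike.not_le_iff_exists.1 fun h => hg₀ (hdet N₀ g₀ h)
  let y : Fin q → L × (Fin p → A) := fun j => (x j, fun i => - w i j)
  let B := Submodule.span A (Set.range y)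
  have hy : ∀ j, B.mkQ (x j, 0) = B.mkQ (0, fun i => w i j) := by
    intro j
    refine (Submodule.Quotient.eq B).2 (Submodule.subset_span ⟨j, ?_⟩)
    ext <;> simp [y]
  refine ⟨(L × (Fin p → A)) ⧸ B, inferInstance, inferInstance, B.mkQ ∘ₗ LinearMap.inl A _ _,
    inferInstance, ?_, ?_⟩
  · rintro ⟨s, hs⟩
    apply hx0
    rw [LinearMap.mem_ker]
    have : x = fun j => ∑ i, w i j • s (B.mkQ (0, Pi.single i 1)) := by
      ext j
      have h1 : s (B.mkQ (x j, 0)) = x j := LinearMap.congr_fun hs (x j)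
      have h2 : ((0 : L), fun i => w i j) = ∑ i, w i j • ((0 : L), (Pi.single i 1 : Fin p → A)) := by
        ext i
        · simp [Prod.fst_sum]
        · simp [Prod.snd_sum, Finset.sum_apply, Pi.single_apply]
      rw [← h1, hy, h2, map_sum, map_sum]
      simp only [LinearMap.map_smul]
    rw [this]
    exact hev _
  · intro N _ _ g hg
    let _ : Module k N := Module.compHom N (algebraMap k A)
    have : IsScalarTower k A N := ⟨fun c a x => by
      rw [Algebra.smul_def, mul_smul]; rfl⟩
    obtain ⟨z, hz⟩ := hle N g hg hx
    refine ⟨B.liftQ (g.coprod (Fintype.linearCombination A z)) ?_, LinearMap.ext fun l => ?_⟩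
    · refine Submodule.span_le.2 ?_
      rintro _ ⟨j, rfl⟩
      simp [y, hz, Fintype.linearCombination_apply]
    · simp

end AlmostSplit

section Pointed

/-- Finitely generated modules with a chosen element. -/
structure PointedModule (A : Type u) [Ring A] : Type (u + 1) where
  /-- the underlying module -/
  carrier : Type u
  [addCommGroup : AddCommGroup carrier]
  [module : Module A carrier]
  [finite : Module.Finite A carrier]
  /-- the chosen element -/
  pt : carrier

attribute [instance] PointedModule.addCommGroup PointedModule.module PointedModule.finite

variable {A : Type u} [Ring A]

namespace PointedModule

/-- `P.lt Q`: there is a pointed map from `Q` to `P` but none in the opposite direction. -/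
def lt (P Q : PointedModule A) : Prop :=
  (∃ f : Q.carrier →ₗ[A] P.carrier, f Q.pt = P.pt) ∧
    ¬ ∃ f : P.carrier →ₗ[A] Q.carrier, f P.pt = Q.pt

/-- A property of pointed modules which passes to one of two complementary summands. -/
def SplitsAlong (Φ : PointedModule A → Prop) : Prop :=
  ∀ (P Q₁ Q₂ : PointedModule A) (f₁ : P.carrier →ₗ[A] Q₁.carrier)
    (f₂ : P.carrier →ₗ[A] Q₂.carrier) (s₁ : Q₁.carrier →ₗ[A] P.carrier)
    (s₂ : Q₂.carrier →ₗ[A] P.carrier), (∀ x, s₁ (f₁ x) + s₂ (f₂ x) = x) → f₁ P.pt = Q₁.pt →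
    f₂ P.pt = Q₂.pt → Φ P → Φ Q₁ ∨ Φ Q₂

theorem exists_indecomposable [IsArtinianRing A] {Φ : PointedModule A → Prop}
    (h0 : ∀ P, Φ P → P.pt ≠ 0) (hs : SplitsAlong Φ) (P : PointedModule A) (hP : Φ P) :
    ∃ Q : PointedModule A, IsIndecomposableModule A Q.carrier ∧ Φ Q ∧
      ∃ f : P.carrier →ₗ[A] Q.carrier, f P.pt = Q.pt := by
  induction hn : Module.length A P.carrier using WellFoundedLT.induction generalizing P with
  | ind n ih =>
  subst hn
  have hfl : IsFiniteLength A P.carrier := isFiniteLength_iff_isNoetherian_isArtinian.2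
    ⟨inferInstance, inferInstance⟩
  by_cases hind : IsIndecomposableModule A P.carrier
  · exact ⟨P, hind, hP, LinearMap.id, rfl⟩
  have : ∃ e : P.carrier →ₗ[A] P.carrier, e ∘ₗ e = e ∧ e ≠ 0 ∧ e ≠ LinearMap.id := by
    by_contra! h
    exact hind ⟨⟨P.pt, h0 P hP⟩, fun e he => or_iff_not_imp_left.2 (h e he)⟩
  obtain ⟨e, he, he0, he1⟩ := this
  have hee : ∀ x, e (e x) = e x := LinearMap.congr_fun he
  let e' : P.carrier →ₗ[A] P.carrier := LinearMap.id - e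
  have key : ∀ p : P.carrier →ₗ[A] P.carrier, LinearMap.range p ≠ ⊤ →
      Φ ⟨LinearMap.range p, p.rangeRestrict P.pt⟩ →
      ∃ Q : PointedModule A, IsIndecomposableModule A Q.carrier ∧ Φ Q ∧
      ∃ f : P.carrier →ₗ[A] Q.carrier, f P.pt = Q.pt := by
    intro p hp hΦ
    obtain ⟨Q, hQ, hΦQ, f, hf⟩ := ih _ (Submodule.length_lt hp) _ hΦ rfl
    exact ⟨Q, hQ, hΦQ, f ∘ₗ p.rangeRestrict, hf⟩
  rcases hs P ⟨LinearMap.range e, e.rangeRestrict P.pt⟩ ⟨LinearMap.range e', e'.rangeRestrict P.pt⟩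
    e.rangeRestrict e'.rangeRestrict (LinearMap.range e).subtype (LinearMap.range e').subtype
    (fun x => by simp [e']) rfl rfl hP with h | h
  · refine key e (fun ht => he1 (LinearMap.ext fun x => ?_)) h
    obtain ⟨y, rfl⟩ := LinearMap.range_eq_top.1 ht x
    exact hee y
  · refine key e' (fun ht => he0 (LinearMap.ext fun x => ?_)) h
    obtain ⟨y, rfl⟩ := LinearMap.range_eq_top.1 ht x
    simp [e', hee]

theorem not_of_wellFounded [IsArtinianRing A] (hwf : WellFounded (lt (A := A)))
    (hlas : ∀ (L : Type u) [AddCommGroup L] [Module A L] [Module.Finite A L],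
      IsIndecomposableModule A L → ∃ (E : Type u) (_ : AddCommGroup E) (_ : Module A E)
        (a : L →ₗ[A] E), Module.Finite A E ∧ IsLeftAlmostSplit a)
    {Φ : PointedModule A → Prop} (h0 : ∀ P, Φ P → P.pt ≠ 0) (hs : SplitsAlong Φ)
    (ha : ∀ (P Q : PointedModule A) (a : P.carrier →ₗ[A] Q.carrier), a P.pt = Q.pt →
      IsIndecomposableModule A P.carrier → IsLeftAlmostSplit a → Φ P → Φ Q)
    (P : PointedModule A) : ¬ Φ P := by
  intro hP
  obtain ⟨P, hP, hmin⟩ := hwf.has_min {P | Φ P} ⟨P, hP⟩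
  obtain ⟨Q, hQ, hΦQ, f, hf⟩ := exists_indecomposable h0 hs P hP
  obtain ⟨E, _, _, a, _, hEa⟩ := hlas Q.carrier hQ
  refine hmin ⟨E, a Q.pt⟩ (ha Q ⟨E, a Q.pt⟩ a rfl hQ hEa hΦQ) ⟨⟨a ∘ₗ f, by simp [hf]⟩, ?_⟩
  rintro ⟨g, hg⟩
  have hfix : (f ∘ₗ g ∘ₗ a) Q.pt = Q.pt := by
    have h1 := congrArg f hg
    exact h1.trans hf
  rcases hQ.isUnit_or_isNilpotent (f ∘ₗ g ∘ₗ a) with hu | ⟨n, hn⟩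
  · obtain ⟨v, hv⟩ := hu.exists_left_inv
    exact hEa.1 ⟨v ∘ₗ f ∘ₗ g, hv⟩
  · refine h0 Q hΦQ ?_
    have : ∀ m : ℕ, ((f ∘ₗ g ∘ₗ a : Module.End A Q.carrier) ^ m) Q.pt = Q.pt := by
      intro m
      induction m with
      | zero => rfl
      | succ m ih => rw [pow_succ, Module.End.mul_apply, hfix, ih]
    rw [← this n, hn]; rfl

end PointedModule
end Pointed

section FiniteType

open CategoryTheory

variable {A : Type u} [Ring A]

namespace PointedModule

variable (k : Type u) [CommRing k] [Algebra k A]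

/-- The elements of `N` which are images of the chosen element of `P`. -/
def images (P : PointedModule A) (N : Type u) [AddCommGroup N] [Module A N] [Module k N]
    [IsScalarTower k A N] : Submodule k N where
  carrier := {x | ∃ f : P.carrier →ₗ[A] N, f P.pt = x}
  add_mem' := by
    rintro _ _ ⟨f, rfl⟩ ⟨g, rfl⟩
    exact ⟨f + g, rfl⟩
  zero_mem' := ⟨0, rfl⟩
  smul_mem' := by
    rintro c _ ⟨f, rfl⟩
    have : SMulCommClass A k N := IsScalarTower.to_smulCommClass'
    exact ⟨c • f, rfl⟩

theorem wellFounded_lt_of_finite [IsArtinianRing k] [Module.Finite k A] [IsArtinianRing A]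
    (h : ∃ (n : ℕ) (M : Fin n → ModuleCat.{u} A), ∀ N : ModuleCat.{u} A, Module.Finite A N →
      IsIndecomposableModule A N → ∃ i, Nonempty (N ≅ M i)) :
    WellFounded (lt (A := A)) := by
  obtain ⟨n, M, hM⟩ := h
  let _ (j : Fin n) : Module k (M j) := Module.compHom (M j) (algebraMap k A)
  have (j : Fin n) : IsScalarTower k A (M j) := ⟨fun c a x => by
    rw [Algebra.smul_def, mul_smul]; rfl⟩
  let ι := {j : Fin n // Module.Finite A (M j)}
  have (j : ι) : Module.Finite A (M j.1) := j.2
  have (j : ι) : Module.Finite k (M j.1) := Module.Finite.trans A _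
  let F : PointedModule A → ∀ j : ι, Submodule k (M j.1) := fun P j => P.images k (M j.1)
  refine Subrelation.wf (r := InvImage (· < ·) F) ?_ (InvImage.wf F wellFounded_lt)
  rintro P Q ⟨⟨f, hf⟩, hPQ⟩
  have hle : F P ≤ F Q := by
    rintro j _ ⟨g, rfl⟩
    exact ⟨g ∘ₗ f, congrArg g hf⟩
  refine lt_of_le_of_ne hle fun heq => ?_
  let Φ : PointedModule A → Prop := fun T => (∃ g : Q.carrier →ₗ[A] T.carrier, g Q.pt = T.pt) ∧
    ¬ ∃ g : P.carrier →ₗ[A] T.carrier, g P.pt = T.pt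
  obtain ⟨T, hT, ⟨⟨g, hg⟩, hT2⟩, -⟩ := exists_indecomposable (Φ := Φ)
    (fun T hT h0 => hT.2 ⟨0, h0.symm⟩) (by
      rintro T T₁ T₂ f₁ f₂ s₁ s₂ hsum h₁ h₂ ⟨⟨g, hg⟩, hT⟩
      by_contra! hcon
      have h3 : ∃ g : P.carrier →ₗ[A] T₁.carrier, g P.pt = T₁.pt := by
        by_contra h; exact hcon.1 ⟨⟨f₁ ∘ₗ g, by simp [hg, h₁]⟩, h⟩
      have h4 : ∃ g : P.carrier →ₗ[A] T₂.carrier, g P.pt = T₂.pt := by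
        by_contra h; exact hcon.2 ⟨⟨f₂ ∘ₗ g, by simp [hg, h₂]⟩, h⟩
      obtain ⟨g₁, hg₁⟩ := h3
      obtain ⟨g₂, hg₂⟩ := h4
      refine hT ⟨s₁ ∘ₗ g₁ + s₂ ∘ₗ g₂, ?_⟩
      simp [hg₁, hg₂, ← h₁, ← h₂, hsum]) Q ⟨⟨LinearMap.id, rfl⟩, hPQ⟩
  obtain ⟨j, ⟨e⟩⟩ := hM (ModuleCat.of A T.carrier) T.finite hT
  let e' : T.carrier ≃ₗ[A] M j := e.toLinearEquiv
  have hfin : Module.Finite A (M j) := Module.Finite.equiv e'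
  have hmem : e' T.pt ∈ F Q ⟨j, hfin⟩ := ⟨e' ∘ₗ g, congrArg e' hg⟩
  rw [← heq] at hmem
  obtain ⟨g', hg'⟩ := hmem
  exact hT2 ⟨e'.symm ∘ₗ g', (congrArg e'.symm hg').trans (e'.symm_apply_apply _)⟩

end PointedModule

theorem exists_finite_retract [IsArtinianRing A] (hwf : WellFounded (PointedModule.lt (A := A)))
    (hlas : ∀ (L : Type u) [AddCommGroup L] [Module A L] [Module.Finite A L],
      IsIndecomposableModule A L → ∃ (E : Type u) (_ : AddCommGroup E) (_ : Module A E)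
        (a : L →ₗ[A] E), Module.Finite A E ∧ IsLeftAlmostSplit a)
    (Z : Type u) [AddCommGroup Z] [Module A Z] [Nontrivial Z] :
    ∃ (L : Type u) (_ : AddCommGroup L) (_ : Module A L) (i : L →ₗ[A] Z) (r : Z →ₗ[A] L),
      Module.Finite A L ∧ Nontrivial L ∧ r ∘ₗ i = LinearMap.id := by
  by_contra hcon
  obtain ⟨z, hz⟩ := exists_ne (0 : Z)
  refine PointedModule.not_of_wellFounded hwf hlas
    (Φ := fun P => ∃ h : P.carrier →ₗ[A] Z, h P.pt ≠ 0) ?_ ?_ ?_ ⟨A, 1⟩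
    ⟨LinearMap.toSpanSingleton A Z z, by simpa using hz⟩
  · rintro P ⟨h, hh⟩ h0
    exact hh (by rw [h0, map_zero])
  · rintro P Q₁ Q₂ f₁ f₂ s₁ s₂ hsum h₁ h₂ ⟨h, hh⟩
    by_contra! h'
    apply hh
    rw [← hsum P.pt, map_add, h₁, h₂]
    have h3 := h'.1 (h ∘ₗ s₁)
    have h4 := h'.2 (h ∘ₗ s₂)
    simp only [LinearMap.comp_apply] at h3 h4
    rw [h3, h4, add_zero]
  · rintro P Q a haP hP ha ⟨h, hh⟩
    obtain ⟨g, hg⟩ := ha.2 Z h (by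
      rintro ⟨s, hs⟩
      exact hcon ⟨P.carrier, inferInstance, inferInstance, h, s, inferInstance,
        ⟨P.pt, 0, fun h0 => hh (by rw [h0, map_zero])⟩, hs⟩)
    refine ⟨g, ?_⟩
    rw [← haP]
    rw [hg] at hh
    exact hh

/-- A partial section of `p` whose domain is locally a finitely generated summand of `Z`. -/
structure IsLocallySplitSection {Y Z : Type u} [AddCommGroup Y] [Module A Y] [AddCommGroup Z]
    [Module A Z] (p : Y →ₗ[A] Z) (f : Z →ₗ.[A] Y) : Prop where
  section_apply : ∀ x, p (f x) = x
  exists_summand : ∀ F : Submodule A Z, F.FG → F ≤ f.domain → ∃ (B : Submodule A Z)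
    (e : Z →ₗ[A] Z), F ≤ B ∧ B ≤ f.domain ∧ (∀ x, e x ∈ B) ∧ ∀ x ∈ B, e x = x

theorem IsLocallySplitSection.exists_extension [IsNoetherianRing A] {Y Z : Type u}
    [AddCommGroup Y] [Module A Y] [AddCommGroup Z] [Module A Z] {p : Y →ₗ[A] Z}
    (hp : ∀ (B : Type u) [AddCommGroup B] [Module A B] [Module.Finite A B] (h : B →ₗ[A] Z),
      ∃ h' : B →ₗ[A] Y, p ∘ₗ h' = h)
    {f : Z →ₗ.[A] Y} (hf : IsLocallySplitSection p f) {L : Type u} [AddCommGroup L] [Module A L]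
    [Module.Finite A L] [Nontrivial L] (i : L →ₗ[A] Z ⧸ f.domain) (r : (Z ⧸ f.domain) →ₗ[A] L)
    (hri : r ∘ₗ i = LinearMap.id) :
    ∃ g, f < g ∧ IsLocallySplitSection p g := by
  obtain ⟨m, π, hπ⟩ := Module.Finite.exists_fin' A L
  obtain ⟨t, ht⟩ := Module.projective_lifting_property f.domain.mkQ (i ∘ₗ π)
    f.domain.mkQ_surjective
  obtain ⟨B, e, hKB, hBf, heB, heq⟩ := hf.exists_summand ((LinearMap.ker π).map t)
    ((IsNoetherian.noetherian _).map t) (by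
      rintro _ ⟨x, hx, rfl⟩
      have h1 : f.domain.mkQ (t x) = i (π x) := LinearMap.congr_fun ht x
      rw [LinearMap.mem_ker.1 hx, map_zero] at h1
      simpa using h1)
  let h : L →ₗ[A] Z := ((LinearMap.ker π).liftQ (t - e ∘ₗ t) (fun x hx => by
    rw [LinearMap.mem_ker, LinearMap.sub_apply, LinearMap.comp_apply,
      heq _ (hKB ⟨x, hx, rfl⟩), sub_self])) ∘ₗ (π.quotKerEquivOfSurjective hπ).symm
  have hh : ∀ l, f.domain.mkQ (h l) = i l := by
    intro l
    obtain ⟨x, rfl⟩ := hπ l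
    have h1 : (π.quotKerEquivOfSurjective hπ).symm (π x) = Submodule.Quotient.mk x := by
      rw [LinearEquiv.symm_apply_eq]; rfl
    have h2 : f.domain.mkQ (e (t x)) = 0 := by simpa using hBf (heB (t x))
    have h3 : f.domain.mkQ (t x) = i (π x) := LinearMap.congr_fun ht x
    simp only [h, LinearMap.comp_apply, LinearEquiv.coe_coe, h1, Submodule.liftQ_apply,
      LinearMap.sub_apply, map_sub, h2, h3, sub_zero]
  let r' : Z →ₗ[A] L := r ∘ₗ f.domain.mkQ
  have hr'h : ∀ l, r' (h l) = l := fun l => by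
    simp only [r', LinearMap.comp_apply, hh]
    exact LinearMap.congr_fun hri l
  have hr'0 : ∀ x ∈ f.domain, r' x = 0 := fun x hx => by
    have : f.domain.mkQ x = 0 := by simpa using hx
    rw [LinearMap.comp_apply, this, map_zero]
  obtain ⟨h', hh'⟩ := hp L h
  let g : Z →ₗ.[A] Y := ⟨LinearMap.range h, h' ∘ₗ r' ∘ₗ (LinearMap.range h).subtype⟩
  have hg : ∀ x : g.domain, g x = h' (r' x) := fun x => rfl
  have hagree : ∀ (x : f.domain) (y : g.domain), (x : Z) = y → f x = g y := by
    rintro x y hxy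
    have hx : r' (x : Z) = 0 := hr'0 _ x.2
    obtain ⟨l, hl⟩ := y.2
    have hl0 : l = 0 := by rw [← hr'h l, hl, ← hxy, hx]
    have hx0 : x = 0 := Subtype.ext (by rw [hxy, ← hl, hl0, map_zero]; rfl)
    rw [hg, ← hxy, hx, hx0, map_zero]
    exact LinearPMap.map_zero f
  refine ⟨f.sup g hagree, lt_of_le_of_ne (LinearPMap.left_le_sup _ _ _) fun heq' => ?_, ?_, ?_⟩
  · obtain ⟨l, hl⟩ := exists_ne (0 : L)
    have h1 : h l ∈ (f.sup g hagree).domain :=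
      le_sup_right (a := f.domain) (LinearMap.mem_range_self h l)
    rw [← heq'] at h1
    exact hl (by rw [← hr'h l, hr'0 _ h1])
  · intro x
    obtain ⟨y, hy, z, hz, hyz⟩ := Submodule.mem_sup.1 x.2
    rw [LinearPMap.sup_apply hagree ⟨y, hy⟩ ⟨z, hz⟩ x hyz, map_add, hf.section_apply, hg,
      ← hyz]
    obtain ⟨l, rfl⟩ := hz
    congr 1
    change p (h' (r' (h l))) = h l
    rw [hr'h]
    exact LinearMap.congr_fun hh' l
  · intro F hF hFle
    have hsub : ∀ x ∈ (f.sup g hagree).domain, x - h (r' x) ∈ f.domain := by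
      intro x hx
      obtain ⟨y, hy, z, ⟨l, rfl⟩, rfl⟩ := Submodule.mem_sup.1 hx
      rw [map_add, hr'0 y hy, hr'h, zero_add]
      simpa using hy
    obtain ⟨B', e', hFB, hB'f, he'B, he'eq⟩ := hf.exists_summand
      (F.map (LinearMap.id - h ∘ₗ r')) (hF.map _) (by
        rintro _ ⟨x, hx, rfl⟩
        exact hsub x (hFle hx))
    refine ⟨B' ⊔ LinearMap.range h, e' ∘ₗ (LinearMap.id - h ∘ₗ r') + h ∘ₗ r', fun x hx => ?_,
      sup_le_sup hB'f le_rfl, fun x => ?_, fun x hx => ?_⟩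
    · exact Submodule.mem_sup.2 ⟨x - h (r' x), hFB ⟨x, hx, rfl⟩, h (r' x), ⟨_, rfl⟩, by simp⟩
    · exact Submodule.mem_sup.2 ⟨_, he'B _, h (r' x), ⟨_, rfl⟩, rfl⟩
    · obtain ⟨y, hy, z, ⟨l, rfl⟩, rfl⟩ := Submodule.mem_sup.1 hx
      simp [hr'0 y (hB'f hy), hr'h, he'eq y hy]

theorem exists_section_of_finite_lifting [IsArtinianRing A]
    (hret : ∀ (Z : Type u) [AddCommGroup Z] [Module A Z] [Nontrivial Z],
    ∃ (L : Type u) (_ : AddCommGroup L) (_ : Module A L) (i : L →ₗ[A] Z) (r : Z →ₗ[A] L),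
      Module.Finite A L ∧ Nontrivial L ∧ r ∘ₗ i = LinearMap.id)
    {Y Z : Type u} [AddCommGroup Y] [Module A Y] [AddCommGroup Z] [Module A Z] (p : Y →ₗ[A] Z)
    (hp : ∀ (B : Type u) [AddCommGroup B] [Module A B] [Module.Finite A B] (h : B →ₗ[A] Z),
      ∃ h' : B →ₗ[A] Y, p ∘ₗ h' = h) :
    ∃ s : Z →ₗ[A] Y, p ∘ₗ s = LinearMap.id := by
  obtain ⟨f, -, hf⟩ := zorn_le_nonempty₀ {f | IsLocallySplitSection p f}
    (fun c hc hchain y hy => by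
      refine ⟨LinearPMap.sSup c hchain.directedOn, ⟨fun x => ?_, fun F hF hFle => ?_⟩,
        fun z hz => LinearPMap.le_sSup _ hz⟩
      · obtain ⟨x, hx⟩ := x
        obtain ⟨g, hg, hxg⟩ := (LinearPMap.mem_domain_sSup_iff ⟨y, hy⟩ hchain.directedOn).1 hx
        have := LinearPMap.sSup_apply hchain.directedOn hg ⟨x, hxg⟩
        rw [this]
        exact (hc hg).section_apply _
      · obtain ⟨_, ⟨g, hg, rfl⟩, hFg⟩ :=
          (CompleteLattice.isCompactElement_iff_le_of_directed_sSup_le _ _).1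
          ((Submodule.fg_iff_compact F).1 hF) (LinearPMap.domain '' c) ⟨_, y, hy, rfl⟩
          (directedOn_image.2 (hchain.directedOn.mono fun _ _ h => h.1)) hFle
        obtain ⟨B, e, h1, h2, h3⟩ := (hc hg).exists_summand F hF hFg
        exact ⟨B, e, h1, h2.trans (LinearPMap.le_sSup hchain.directedOn hg).1, h3⟩)
    ⊥ ⟨fun x => by
      have : x = 0 := Subtype.ext ((Submodule.mem_bot A).1 x.2)
      rw [this, LinearPMap.map_zero, map_zero]; rfl, fun F _ hF => ⟨⊥, 0, hF, le_rfl, fun x => by simp,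
        fun x hx => by simpa using ((Submodule.mem_bot A).1 hx).symm⟩⟩
  have htop : f.domain = ⊤ := by
    by_contra hne
    have : Nontrivial (Z ⧸ f.domain) := Submodule.Quotient.nontrivial_iff.2 hne
    obtain ⟨L, _, _, i, r, _, _, hri⟩ := hret (Z ⧸ f.domain)
    obtain ⟨g, hlt, hg⟩ := IsLocallySplitSection.exists_extension hp hf.prop i r hri
    exact hlt.not_ge (hf.2 hg hlt.le)
  refine ⟨f.toFun ∘ₗ (LinearMap.id.codRestrict f.domain fun x => htop ▸ Submodule.mem_top),
    LinearMap.ext fun x => hf.prop.section_apply _⟩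

end FiniteType

section Chase

variable {A : Type u} [Ring A]

namespace PointedModule

/-- The additive subgroup of images of the chosen element of `P`. -/
def imageGroup (P : PointedModule A) (N : Type u) [AddCommGroup N] [Module A N] :
    AddSubgroup N where
  carrier := {x | ∃ f : P.carrier →ₗ[A] N, f P.pt = x}
  add_mem' := by
    rintro _ _ ⟨f, rfl⟩ ⟨g, rfl⟩
    exact ⟨f + g, rfl⟩
  zero_mem' := ⟨0, rfl⟩
  neg_mem' := by
    rintro _ ⟨f, rfl⟩
    exact ⟨-f, rfl⟩

theorem map_mem_imageGroup {P : PointedModule A} {N N' : Type u} [AddCommGroup N] [Module A N]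
    [AddCommGroup N'] [Module A N'] (φ : N →ₗ[A] N') {x : N} (hx : x ∈ P.imageGroup N) :
    φ x ∈ P.imageGroup N' := by
  obtain ⟨f, rfl⟩ := hx
  exact ⟨φ ∘ₗ f, rfl⟩

theorem mem_imageGroup_pi {P : PointedModule A} {N : ℕ → Type u}
    [∀ i, AddCommGroup (N i)] [∀ i, Module A (N i)] {x : ∀ i, N i}
    (hx : ∀ i, x i ∈ P.imageGroup (N i)) : x ∈ P.imageGroup (∀ i, N i) := by
  choose f hf using hx
  exact ⟨LinearMap.pi f, funext hf⟩

theorem mem_imageGroup_finsupp {P : PointedModule A} {I X : Type u} [AddCommGroup X] [Module A X]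
    {x : I →₀ X} (hx : ∀ i, x i ∈ P.imageGroup X) : x ∈ P.imageGroup (I →₀ X) := by
  rw [← x.sum_single]
  exact AddSubgroup.sum_mem _ fun i _ => map_mem_imageGroup (Finsupp.lsingle i) (hx i)

variable {P : ℕ → PointedModule A}

theorem imageGroup_antitone (hP : ∀ n, lt (P (n + 1)) (P n)) (N : Type u) [AddCommGroup N]
    [Module A N] : Antitone fun n => (P n).imageGroup N := by
  refine antitone_nat_of_succ_le fun n => ?_
  rintro _ ⟨f, rfl⟩
  obtain ⟨g, hg⟩ := (hP n).1
  exact ⟨f ∘ₗ g, congrArg f hg⟩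

/-- Chase's lemma: a map from a countable product to a direct sum sends, up to finitely many
coordinates, deep elements to elements lying in all subgroups of the chain. -/
theorem exists_finset_forall_mem_imageGroup (hP : ∀ n, lt (P (n + 1)) (P n)) {B : ℕ → Type u}
    [∀ n, AddCommGroup (B n)] [∀ n, Module A (B n)] {I X : Type u} [AddCommGroup X] [Module A X]
    (s : (∀ n, B n) →ₗ[A] (I →₀ X)) :
    ∃ (m : ℕ) (F : Finset I), ∀ y ∈ (P m).imageGroup (∀ n, B n), (∀ i < m, y i = 0) →
      ∀ j ∉ F, ∀ n, s y j ∈ (P n).imageGroup X := by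
  classical
  by_contra! hcon
  choose Y hY hY0 J hJ N hN using hcon
  let st : ℕ → ℕ × Finset I := fun k => Nat.rec (0, ∅) (fun _ p =>
    (max (N p.1 p.2) (p.1 + 1), p.2 ∪ insert (J p.1 p.2) (s (Y p.1 p.2)).support)) k
  let y : ℕ → ∀ n, B n := fun k => Y (st k).1 (st k).2
  let j : ℕ → I := fun k => J (st k).1 (st k).2
  have hst1 : ∀ k, (st k).1 < (st (k + 1)).1 := fun k =>
    lt_of_lt_of_le (Nat.lt_succ_self _) (le_max_right _ _)
  have hst1m : StrictMono fun k => (st k).1 := strictMono_nat_of_lt_succ hst1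
  have hst2 : ∀ k, (st (k + 1)).2 = (st k).2 ∪ insert (j k) (s (y k)).support := fun k => rfl
  have hst2m : Monotone fun k => (st k).2 := monotone_nat_of_le_succ fun k => by
    simp only [hst2]; exact Finset.subset_union_left
  have hsub : ∀ l k, l < k → insert (j l) (s (y l)).support ⊆ (st k).2 := fun l k hlk =>
    (show _ ⊆ (st (l + 1)).2 by rw [hst2]; exact Finset.subset_union_right).trans
      (hst2m (Nat.succ_le_of_lt hlk))
  have hj : Function.Injective j := by
    refine Function.Injective.of_lt_imp_ne fun l k hlk h => ?_
    have h1 : j l ∈ (st k).2 := hsub l k hlk (Finset.mem_insert_self _ _)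
    rw [h] at h1
    exact hJ (st k).1 (st k).2 h1
  have hy0 : ∀ k n, n < k → y k n = 0 := fun k n h =>
    hY0 _ _ n (h.trans_le hst1m.le_apply)
  let z : ∀ n, B n := fun n => ∑ l ∈ Finset.range (n + 1), y l n
  have hz : ∀ k, ∃ t ∈ (P (N (st k).1 (st k).2)).imageGroup (∀ n, B n),
      z = ∑ l ∈ Finset.range k, y l + y k + t := by
    intro k
    refine ⟨fun n => ∑ i ∈ Finset.range n, y (k + 1 + i) n, ?_, ?_⟩
    · refine mem_imageGroup_pi fun n => AddSubgroup.sum_mem _ fun i _ => ?_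
      refine imageGroup_antitone hP _ ?_
        (map_mem_imageGroup (LinearMap.proj (R := A) (φ := B) n) (hY _ _))
      exact (le_max_left _ _).trans (hst1m.monotone (Nat.le_add_right (k + 1) i))
    · ext n
      rw [← Finset.sum_range_succ]
      simp only [Pi.add_apply, Finset.sum_apply, z]
      rw [← Finset.sum_range_add (fun l => y l n)]
      refine Finset.sum_subset (Finset.range_mono (by omega)) fun l _ hl => hy0 l n ?_
      simpa using hl
  refine Set.infinite_of_injective_forall_mem hj (s := ((s z).support : Set I)) (fun k => ?_)
    (s z).support.finite_toSet
  rw [Finset.mem_coe, Finsupp.mem_support_iff]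
  intro h0
  obtain ⟨t, ht, hzt⟩ := hz k
  refine hN (st k).1 (st k).2 ?_
  have h1 : ∀ l ∈ Finset.range k, s (y l) (j k) = 0 := by
    intro l hl
    by_contra h
    exact hJ (st k).1 (st k).2 (hsub l k (Finset.mem_range.1 hl)
      (Finset.mem_insert_of_mem (Finsupp.mem_support_iff.2 h)))
  rw [hzt, map_add, map_add, map_sum, Finsupp.add_apply, Finsupp.add_apply,
    Finsupp.finsetSum_apply, Finset.sum_eq_zero h1, zero_add] at h0
  change s (y k) (j k) ∈ _
  rw [eq_neg_of_add_eq_zero_left h0]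
  exact AddSubgroup.neg_mem _ (map_mem_imageGroup (Finsupp.lapply (R := A) (j k) ∘ₗ s) ht)

theorem wellFounded_lt_of_retract {X : Type u} [AddCommGroup X] [Module A X]
    (hX : ∀ (Y : Type u) [AddCommGroup Y] [Module A Y], ∃ (I : Type u) (s : Y →ₗ[A] (I →₀ X))
      (r : (I →₀ X) →ₗ[A] Y), r ∘ₗ s = LinearMap.id) :
    WellFounded (lt (A := A)) := by
  classical
  rw [wellFounded_iff_isEmpty_descending_chain]
  refine ⟨fun ⟨P, hP⟩ => ?_⟩
  obtain ⟨I, s, r, hrs⟩ := hX (∀ n, Set (ℕ → X) →₀ (P n).carrier)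
  obtain ⟨m, F, hF⟩ := exists_finset_forall_mem_imageGroup hP s
  let e (α : Set (ℕ → X)) : (P m).carrier →ₗ[A] ∀ n, Set (ℕ → X) →₀ (P n).carrier :=
    LinearMap.single A _ m ∘ₗ Finsupp.lsingle α
  obtain ⟨ν, hν⟩ := Countable.exists_injective_nat F
  let c : Set (ℕ → X) → ℕ → X := fun α i => if h : ∃ j, ν j = i then s (e α (P m).pt) h.choose
    else 0
  obtain ⟨α, β, hαβ, hne⟩ : ∃ α β, c α = c β ∧ α ≠ β := by
    by_contra! h
    exact Function.cantor_injective c h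
  have hc : ∀ j ∈ F, s (e α (P m).pt) j = s (e β (P m).pt) j := by
    intro j hj
    have h1 : ∃ j', ν j' = ν ⟨j, hj⟩ := ⟨_, rfl⟩
    have h2 := congrFun hαβ (ν ⟨j, hj⟩)
    have h3 : h1.choose = ⟨j, hj⟩ := hν h1.choose_spec
    simp only [c, dif_pos h1, h3] at h2
    exact h2
  let y := (e α - e β) (P m).pt
  have hy : ∀ j, s y j ∈ (P (m + 1)).imageGroup X := by
    intro j
    by_cases hj : j ∈ F
    · have : s y j = 0 := by simp [y, hc j hj]
      rw [this]
      exact zero_mem _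
    · refine hF y ⟨_, rfl⟩ (fun i hi => ?_) j hj _
      simp [y, e, hi.ne]
  have hy' : y ∈ (P (m + 1)).imageGroup _ := by
    have := map_mem_imageGroup r (mem_imageGroup_finsupp hy)
    rwa [← LinearMap.comp_apply, hrs] at this
  have h := map_mem_imageGroup (Finsupp.lapply (R := A) α ∘ₗ LinearMap.proj m) hy'
  obtain ⟨g, hg⟩ := h
  refine (hP m).2 ⟨g, hg.trans ?_⟩
  simp [y, e, hne]

end PointedModule
end Chase

section FinitelyManyIndecomposables

open CategoryTheory

variable {A : Type u} [Ring A]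

/-- Up to isomorphism, only finitely many finitely generated indecomposable modules admit a map
from `P` which does not kill the chosen element. -/
def PointedModule.HasFiniteSupport (P : PointedModule A) : Prop :=
  ∃ l : List (ModuleCat.{u} A), ∀ N : ModuleCat.{u} A, Module.Finite A N →
    IsIndecomposableModule A N → (∃ h : P.carrier →ₗ[A] N, h P.pt ≠ 0) →
      ∃ M ∈ l, Nonempty (N ≅ M)

theorem finite_type_of_wellFounded [IsArtinianRing A]
    (hwf : WellFounded (PointedModule.lt (A := A)))
    (hlas : ∀ (L : Type u) [AddCommGroup L] [Module A L] [Module.Finite A L],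
      IsIndecomposableModule A L → ∃ (E : Type u) (_ : AddCommGroup E) (_ : Module A E)
        (a : L →ₗ[A] E), Module.Finite A E ∧ IsLeftAlmostSplit a) :
    ∃ (n : ℕ) (M : Fin n → ModuleCat.{u} A), ∀ N : ModuleCat.{u} A, Module.Finite A N →
      IsIndecomposableModule A N → ∃ i, Nonempty (N ≅ M i) := by
  have key : ∀ P : PointedModule A, P.HasFiniteSupport := by
    intro P
    by_contra hP
    refine PointedModule.not_of_wellFounded hwf hlas
      (Φ := fun P => ¬ P.HasFiniteSupport) ?_ ?_ ?_ P hP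
    · intro P hP h0
      exact hP ⟨[], fun N _ _ ⟨h, hh⟩ => absurd (by rw [h0, map_zero]) hh⟩
    · intro P Q₁ Q₂ f₁ f₂ s₁ s₂ hs h₁ h₂ hP
      by_contra! hcon
      obtain ⟨⟨l₁, hl₁⟩, ⟨l₂, hl₂⟩⟩ := hcon
      refine hP ⟨l₁ ++ l₂, fun N hN hi ⟨h, hh⟩ => ?_⟩
      by_cases hz : h (s₁ Q₁.pt) = 0
      · obtain ⟨M, hM, e⟩ := hl₂ N hN hi ⟨h ∘ₗ s₂, fun hz' => hh <| by
          rw [← hs P.pt, h₁, h₂, map_add, hz, zero_add]; exact hz'⟩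
        exact ⟨M, List.mem_append_right _ hM, e⟩
      · obtain ⟨M, hM, e⟩ := hl₁ N hN hi ⟨h ∘ₗ s₁, hz⟩
        exact ⟨M, List.mem_append_left _ hM, e⟩
    · rintro P Q a haP hi ha hP ⟨l, hl⟩
      refine hP ⟨ModuleCat.of A P.carrier :: l, fun N hN hNi ⟨h, hh⟩ => ?_⟩
      by_cases hsp : ∃ s : N →ₗ[A] P.carrier, s ∘ₗ h = LinearMap.id
      · obtain ⟨s, hs⟩ := hsp
        have hid : h ∘ₗ s = LinearMap.id := by
          refine (hNi.2 (h ∘ₗ s) ?_).resolve_left fun h0 => hh ?_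
          · exact LinearMap.ext fun x => congrArg h (LinearMap.congr_fun hs (s x))
          · have := LinearMap.congr_fun h0 (h P.pt)
            exact (congrArg h (LinearMap.congr_fun hs P.pt)).symm.trans this
        exact ⟨_, List.mem_cons_self, ⟨(LinearEquiv.ofLinearMap s h hs hid).toModuleIso⟩⟩
      · obtain ⟨g, rfl⟩ := ha.2 N h hsp
        obtain ⟨M, hM, e⟩ := hl N hN hNi ⟨g, by rw [← haP]; exact hh⟩
        exact ⟨M, List.mem_cons_of_mem _ hM, e⟩
  obtain ⟨l, hl⟩ := key ⟨A, 1⟩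
  refine ⟨l.length, l.get, fun N hN hi => ?_⟩
  obtain ⟨x, hx⟩ := hi.1
  obtain ⟨M, hM, e⟩ := hl N hN hi ⟨LinearMap.toSpanSingleton A N x, by simpa using hx⟩
  obtain ⟨i, rfl⟩ := List.get_of_mem hM
  exact ⟨i, e⟩

end FinitelyManyIndecomposables

section Complexes

open CategoryTheory CategoryTheory.Limits

variable {A : Type u} [Ring A]

/-- Componentwise description of null-homotopic cochain maps. -/
theorem quotient_map_eq_zero_iff_exists {Z C : CochainComplex (ModuleCat.{u} A) ℤ} (f : Z ⟶ C) :
    (HomotopyCategory.quotient (ModuleCat.{u} A) (ComplexShape.up ℤ)).map f = 0 ↔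
      ∃ s : ∀ n : ℤ, Z.X (n + 1) ⟶ C.X n, ∀ n : ℤ,
        f.f (n + 1) = Z.d (n + 1) (n + 1 + 1) ≫ s (n + 1) + s n ≫ C.d n (n + 1) := by
  rw [HomotopyCategory.quotient_map_eq_zero_iff]
  constructor
  · rintro ⟨h⟩
    refine ⟨fun n => h.hom (n + 1) n, fun n => ?_⟩
    have := h.comm (n + 1)
    rw [dNext_eq h.hom (show (ComplexShape.up ℤ).Rel (n + 1) (n + 1 + 1) from rfl),
      prevD_eq h.hom (show (ComplexShape.up ℤ).Rel n (n + 1) from rfl)] at this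
    simpa using this
  · rintro ⟨s, hs⟩
    let hom : ∀ i j : ℤ, (ComplexShape.up ℤ).Rel j i → (Z.X i ⟶ C.X j) := fun i j hij =>
      (Z.XIsoOfEq (show i = j + 1 from hij.symm)).hom ≫ s j
    refine ⟨(Homotopy.ofEq ?_).trans (Homotopy.nullHomotopy' hom)⟩
    ext1 n
    obtain ⟨m, rfl⟩ : ∃ m, n = m + 1 := ⟨n - 1, by ring⟩
    rw [Homotopy.nullHomotopicMap'_f (show (ComplexShape.up ℤ).Rel m (m + 1) from rfl)
      (show (ComplexShape.up ℤ).Rel (m + 1) (m + 1 + 1) from rfl), hs m]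
    simp [hom]

end Complexes

section Resolution

open CategoryTheory CategoryTheory.Limits

variable {A : Type u} [Ring A]

/-- The evaluation map from the canonical direct sum of copies of `X`. -/
noncomputable def evaluation (X N : Type u) [AddCommGroup X] [Module A X] [AddCommGroup N]
    [Module A N] : ((X →ₗ[A] N) →₀ X) →ₗ[A] N :=
  Finsupp.lsum ℕ fun h => h

theorem exists_evaluation_comp {X V : Type u} (N : Type u) [AddCommGroup X] [Module A X]
    [AddCommGroup N] [Module A N] [AddCommGroup V] [Module A V] (i : V →ₗ[A] X) (r : X →ₗ[A] V)
    (hr : r ∘ₗ i = LinearMap.id) (g : V →ₗ[A] N) :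
    ∃ g' : V →ₗ[A] ((X →ₗ[A] N) →₀ X), evaluation X N ∘ₗ g' = g := by
  refine ⟨Finsupp.lsingle (g ∘ₗ r) ∘ₗ i, LinearMap.ext fun x => ?_⟩
  have : r (i x) = x := LinearMap.congr_fun hr x
  simp [evaluation, this]

/-- The iterated kernels of the canonical resolution of `Y` by direct sums of copies of `X`. -/
noncomputable def syzygy (X : Type u) [AddCommGroup X] [Module A X] (Y : ModuleCat.{u} A) :
    ℕ → ModuleCat.{u} A
  | 0 => Y
  | n + 1 => ModuleCat.of A (LinearMap.ker (evaluation (A := A) X (syzygy X Y n)))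

/-- The terms of the canonical resolution of `Y`, augmented by `Y` in degree `0`. -/
noncomputable def resolution (X : Type u) [AddCommGroup X] [Module A X] (Y : ModuleCat.{u} A) :
    ℕ → ModuleCat.{u} A
  | 0 => Y
  | n + 1 => ModuleCat.of A ((X →ₗ[A] syzygy X Y n) →₀ X)

/-- The differential of the augmented canonical resolution. -/
noncomputable def resolutionD (X : Type u) [AddCommGroup X] [Module A X] (Y : ModuleCat.{u} A) :
    ∀ n, resolution X Y (n + 1) →ₗ[A] resolution X Y n
  | 0 => evaluation X Y
  | n + 1 => (LinearMap.ker (evaluation (A := A) X (syzygy X Y n))).subtype ∘ₗ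
      evaluation X (syzygy X Y (n + 1))

variable (X : Type u) [AddCommGroup X] [Module A X] (Y : ModuleCat.{u} A)

theorem resolutionD_comp_resolutionD (n : ℕ) (x) :
    resolutionD X Y n (resolutionD X Y (n + 1) x) = 0 := by
  cases n with
  | zero => exact (evaluation X (syzygy X Y 1) x).2
  | succ n =>
    have h : evaluation X (syzygy X Y (n + 1)) (evaluation X (syzygy X Y (n + 2)) x).1 = 0 :=
      (evaluation X (syzygy X Y (n + 2)) x).2
    exact congrArg (LinearMap.ker (evaluation (A := A) X (syzygy X Y n))).subtype h

theorem resolution_lift_succ {V : Type u} [AddCommGroup V] [Module A V] (i : V →ₗ[A] X)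
    (r : X →ₗ[A] V) (hr : r ∘ₗ i = LinearMap.id) (n : ℕ) (g : V →ₗ[A] resolution X Y (n + 1))
    (hg : resolutionD X Y n ∘ₗ g = 0) :
    ∃ g', resolutionD X Y (n + 1) ∘ₗ g' = g := by
  have hg' : ∀ x, evaluation X (syzygy X Y n) (g x) = 0 := by
    intro x
    have h := LinearMap.congr_fun hg x
    cases n with
    | zero => exact h
    | succ n => exact Subtype.ext h
  obtain ⟨g', h⟩ := exists_evaluation_comp (syzygy X Y (n + 1)) i r hr
    (LinearMap.codRestrict (LinearMap.ker (evaluation X (syzygy X Y n))) g hg')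
  refine ⟨g', LinearMap.ext fun x => ?_⟩
  exact congrArg Subtype.val (LinearMap.congr_fun h x)

/-- The endomorphism of the product of all terms of the resolution given by its differential. -/
noncomputable def totalD : (∀ n, resolution X Y n) →ₗ[A] (∀ n, resolution X Y n) :=
  LinearMap.pi fun n => resolutionD X Y n ∘ₗ LinearMap.proj (n + 1)

theorem exists_nat_sequence {β : ℕ → Type*} (r : ∀ n, β n → β (n + 1) → Prop) (b : β 0)
    (h : ∀ n b, ∃ b', r n b b') : ∃ s : ∀ n, β n, ∀ n, r n (s n) (s (n + 1)) :=
  ⟨fun n => Nat.rec b (fun n x => (h n x).choose) n, fun n => (h n _).choose_spec⟩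

/-- Any map from a complex whose terms are direct summands of `X` to the unrolled resolution is
null-homotopic. -/
theorem exists_nullHomotopy_totalD (Z : ℤ → Type u) [∀ n, AddCommGroup (Z n)]
    [∀ n, Module A (Z n)] (i : ∀ n, Z n →ₗ[A] X) (r : ∀ n, X →ₗ[A] Z n)
    (hr : ∀ n, r n ∘ₗ i n = LinearMap.id) (d : ∀ n, Z n →ₗ[A] Z (n + 1))
    (hd : ∀ n x, d (n + 1) (d n x) = 0) (f : ∀ n, Z n →ₗ[A] ∀ j, resolution X Y j)
    (hf : ∀ n x, totalD X Y (f n x) = f (n + 1) (d n x)) :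
    ∃ s : ∀ n, Z (n + 1) →ₗ[A] ∀ j, resolution X Y j, ∀ n x,
      f (n + 1) x = s (n + 1) (d (n + 1) x) + totalD X Y (s n x) := by
  let Liftable (j : ℕ) (t : ∀ n, Z (n + 1) →ₗ[A] resolution X Y j) : Prop :=
    ∀ n, ∃ t' : Z (n + 1) →ₗ[A] resolution X Y (j + 1),
      resolutionD X Y j ∘ₗ t' = LinearMap.proj j ∘ₗ f (n + 1) - t (n + 1) ∘ₗ d (n + 1)
  have h0 : Liftable 0 0 := fun n => exists_evaluation_comp Y (i (n + 1)) _ (hr (n + 1)) _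
  have hstep (j : ℕ) (t) (ht : Liftable j t) : Liftable (j + 1) fun n => (ht n).choose := by
    intro n
    refine resolution_lift_succ X Y (i (n + 1)) _ (hr (n + 1)) j _ (LinearMap.ext fun x => ?_)
    have h₁ := LinearMap.congr_fun (ht (n + 1)).choose_spec (d (n + 1) x)
    have h₂ := congrFun (hf (n + 1) x) j
    simp only [LinearMap.comp_apply, LinearMap.sub_apply, hd, map_zero, sub_zero] at h₁
    simp only [LinearMap.comp_apply, LinearMap.sub_apply, map_sub, LinearMap.zero_apply, h₁]
    exact sub_eq_zero.2 h₂
  obtain ⟨s, hs⟩ := exists_nat_sequence (β := fun j => {t // Liftable j t})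
    (fun j t t' => ∀ n, resolutionD X Y j ∘ₗ t'.1 n =
      LinearMap.proj j ∘ₗ f (n + 1) - t.1 (n + 1) ∘ₗ d (n + 1)) ⟨0, h0⟩
    fun j t => ⟨⟨_, hstep j t.1 t.2⟩, fun n => (t.2 n).choose_spec⟩
  refine ⟨fun n => LinearMap.pi fun j => (s j).1 n, fun n x => funext fun j => ?_⟩
  have := LinearMap.congr_fun (hs j n) x
  exact (sub_eq_iff_eq_add'.1 this.symm)

/-- The unrolled resolution as a cochain complex. -/
noncomputable def unrolledResolution : CochainComplex (ModuleCat.{u} A) ℤ :=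
  CochainComplex.of (fun _ => ModuleCat.of A (∀ n, resolution X Y n))
    (fun _ => ModuleCat.ofHom (totalD X Y)) fun _ => by
      refine ModuleCat.hom_ext (LinearMap.ext fun x => ?_)
      exact funext fun n => resolutionD_comp_resolutionD X Y n (x (n + 1 + 1))

theorem unrolledResolution_d (n : ℤ) :
    (unrolledResolution X Y).d n (n + 1) = ModuleCat.ofHom (totalD X Y) :=
  CochainComplex.of_d (fun _ : ℤ => ModuleCat.of A (∀ n, resolution X Y n))
    (fun _ => ModuleCat.ofHom (totalD X Y)) n

/-- If the unrolled resolution is contractible, then `Y` is a direct summand of a direct sum of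
copies of `X`. -/
theorem exists_retract_of_contractible
    (h : (HomotopyCategory.quotient (ModuleCat.{u} A) (ComplexShape.up ℤ)).map
      (𝟙 (unrolledResolution X Y)) = 0) :
    ∃ (I : Type u) (s : Y →ₗ[A] (I →₀ X)) (r : (I →₀ X) →ₗ[A] Y), r ∘ₗ s = LinearMap.id := by
  obtain ⟨s, hs⟩ := (quotient_map_eq_zero_iff_exists _).1 h
  let s0 : (∀ n, resolution X Y n) →ₗ[A] ∀ n, resolution X Y n := (s 0).hom
  let s1 : (∀ n, resolution X Y n) →ₗ[A] ∀ n, resolution X Y n := (s (0 + 1)).hom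
  have hs0 (x) : x = s1 (totalD X Y x) + totalD X Y (s0 x) := by
    have := hs 0
    rw [unrolledResolution_d, unrolledResolution_d] at this
    exact LinearMap.congr_fun (congrArg ModuleCat.Hom.hom this) x
  refine ⟨X →ₗ[A] Y, LinearMap.proj (R := A) (φ := fun n => resolution X Y n) 1 ∘ₗ s0 ∘ₗ
    LinearMap.single A (fun n => resolution X Y n) 0, evaluation X Y,
    LinearMap.ext fun (y : resolution X Y 0) => ?_⟩
  have hz : totalD X Y (LinearMap.single A (fun n => resolution X Y n) 0 y) = 0 := by
    funext n
    exact (congrArg (resolutionD X Y n) (Pi.single_eq_of_ne (M := fun n => resolution X Y n)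
      n.succ_ne_zero y)).trans (map_zero _)
  have := congrFun (hs0 (LinearMap.single A (fun n => resolution X Y n) 0 y)) 0
  rw [hz, map_zero, zero_add] at this
  exact this.symm.trans (Pi.single_eq_same (M := fun n => resolution X Y n) 0 y)

/-- If a set of complexes detects contractibility, then all modules are direct summands of direct
sums of copies of a single module. -/
theorem exists_module_retract_of_detects {ι : Type u}
    (Z : ι → CochainComplex (ModuleCat.{u} A) ℤ)
    (hZ : ∀ C : CochainComplex (ModuleCat.{u} A) ℤ,
      (∀ i (f : Z i ⟶ C),
        (HomotopyCategory.quotient (ModuleCat.{u} A) (ComplexShape.up ℤ)).map f = 0) →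
      (HomotopyCategory.quotient (ModuleCat.{u} A) (ComplexShape.up ℤ)).map (𝟙 C) = 0) :
    ∃ (X : Type u) (_ : AddCommGroup X) (_ : Module A X),
      ∀ (Y : Type u) [AddCommGroup Y] [Module A Y], ∃ (I : Type u) (s : Y →ₗ[A] (I →₀ X))
        (r : (I →₀ X) →ₗ[A] Y), r ∘ₗ s = LinearMap.id := by
  classical
  refine ⟨∀ p : ι × ℤ, (Z p.1).X p.2, inferInstance, inferInstance, fun Y _ _ =>
    exists_retract_of_contractible _ (ModuleCat.of A Y) (hZ _ fun i f => ?_)⟩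
  obtain ⟨s, hs⟩ := exists_nullHomotopy_totalD (∀ p : ι × ℤ, (Z p.1).X p.2) (ModuleCat.of A Y)
    (fun n => (Z i).X n) (fun n => LinearMap.single A (fun p : ι × ℤ => (Z p.1).X p.2) (i, n))
    (fun n => LinearMap.proj (i, n)) (fun n => LinearMap.ext fun x => by simp)
    (fun n => ((Z i).d n (n + 1)).hom)
    (fun n x => LinearMap.congr_fun (congrArg ModuleCat.Hom.hom
      ((Z i).d_comp_d n (n + 1) (n + 1 + 1))) x)
    (fun n => (f.f n).hom) (fun n x => by
      have := LinearMap.congr_fun (congrArg ModuleCat.Hom.hom (f.comm n (n + 1))) x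
      rw [unrolledResolution_d] at this
      exact this)
  refine (quotient_map_eq_zero_iff_exists f).2 ⟨fun n => ModuleCat.ofHom (s n), fun n => ?_⟩
  rw [unrolledResolution_d]
  ext x
  exact hs n x

end Resolution

section Generators

open CategoryTheory CategoryTheory.Limits

variable {A : Type u} [Ring A]

theorem exists_module_retract_of_nondegenerate
    {S : Set (HomotopyCategory (ModuleCat.{u} A) (ComplexShape.up ℤ))} (hS : Small.{u} S)
    (hnd : ∀ X : HomotopyCategory (ModuleCat.{u} A) (ComplexShape.up ℤ),
      (∀ Y ∈ S, ∀ f : Y ⟶ X, f = 0) → IsZero X) :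
    ∃ (X : Type u) (_ : AddCommGroup X) (_ : Module A X),
      ∀ (Y : Type u) [AddCommGroup Y] [Module A Y], ∃ (I : Type u) (s : Y →ₗ[A] (I →₀ X))
        (r : (I →₀ X) →ₗ[A] Y), r ∘ₗ s = LinearMap.id := by
  refine exists_module_retract_of_detects
    (fun i : Shrink.{u} S => ((equivShrink S).symm i).1.as) fun C hC => ?_
  have hz : IsZero ((HomotopyCategory.quotient (ModuleCat.{u} A) (ComplexShape.up ℤ)).obj C) := by
    refine hnd _ fun Y hY f => ?_
    have key : ∀ y : S, ∀ g : y.1.as ⟶ C,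
        (HomotopyCategory.quotient (ModuleCat.{u} A) (ComplexShape.up ℤ)).map g = 0 := by
      intro y
      obtain ⟨i, rfl⟩ := (equivShrink S).symm.surjective y
      exact hC i
    obtain ⟨g, rfl⟩ := (HomotopyCategory.quotient (ModuleCat.{u} A)
      (ComplexShape.up ℤ)).map_surjective (X := Y.as) (Y := C) f
    exact key ⟨Y, hY⟩ g
  rw [CategoryTheory.Functor.map_id]
  exact (IsZero.iff_id_eq_zero _).1 hz

end Generators

section Coproducts

open CategoryTheory CategoryTheory.Limits

variable {A : Type u} [Ring A] {I : Type u}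

/-- The direct sum of a family of complexes. -/
noncomputable def directSum (K : I → CochainComplex (ModuleCat.{u} A) ℤ) :
    CochainComplex (ModuleCat.{u} A) ℤ where
  X n := ModuleCat.of A (Π₀ i, (K i).X n)
  d m n := ModuleCat.ofHom (DFinsupp.mapRange.linearMap fun i => ((K i).d m n).hom)
  shape m n h := by
    refine ModuleCat.hom_ext (LinearMap.ext fun (x : Π₀ i, (K i).X m) => DFinsupp.ext fun i => ?_)
    exact LinearMap.congr_fun (congrArg ModuleCat.Hom.hom ((K i).shape m n h)) (x i)
  d_comp_d' l m n _ _ := by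
    refine ModuleCat.hom_ext (LinearMap.ext fun (x : Π₀ i, (K i).X l) => DFinsupp.ext fun i => ?_)
    exact LinearMap.congr_fun (congrArg ModuleCat.Hom.hom ((K i).d_comp_d l m n)) (x i)

namespace directSum

variable (K : I → CochainComplex (ModuleCat.{u} A) ℤ)

open Classical in
/-- The inclusion of a summand. -/
noncomputable def ι (i : I) : K i ⟶ directSum K where
  f n := ModuleCat.ofHom (DFinsupp.lsingle (M := fun i => (K i).X n) i)
  comm' m n _ := by
    refine ModuleCat.hom_ext (LinearMap.ext fun x => ?_)
    exact DFinsupp.mapRange_single (f := fun i => ((K i).d m n).hom)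
      (hf := fun i => map_zero _)

/-- The projection to a summand. -/
noncomputable def π (i : I) : directSum K ⟶ K i where
  f n := ModuleCat.ofHom (DFinsupp.lapply (M := fun i => (K i).X n) i)
  comm' _ _ _ := rfl

variable {K}

theorem sum_apply (J : Finset I) {n : ℤ} (x : Π₀ i, (K i).X n) (hJ : ∀ i, x i ≠ 0 → i ∈ J) :
    (∑ j ∈ J, π K j ≫ ι K j).f n x = x := by
  classical
  let ev : (directSum K ⟶ directSum K) →+ (Π₀ i, (K i).X n) :=
    { toFun := fun g => g.f n x, map_zero' := rfl, map_add' := fun _ _ => rfl }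
  refine (map_sum ev _ _).trans (DFinsupp.ext fun i => ?_)
  have h (j : I) : ev (π K j ≫ ι K j) = DFinsupp.single j (x j) := rfl
  simp only [h, DFinsupp.finsetSum_apply, DFinsupp.single_apply]
  by_cases hi : i ∈ J
  · simp [hi]
  · rw [of_not_not (mt (hJ i) hi)]
    exact Finset.sum_eq_zero fun j hj => dif_neg fun hji : j = i => hi (hji ▸ hj)

open Classical in
/-- The map out of the direct sum given by its components. -/
noncomputable def desc {C : CochainComplex (ModuleCat.{u} A) ℤ} (φ : ∀ i, K i ⟶ C) :
    directSum K ⟶ C where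
  f n := ModuleCat.ofHom (DFinsupp.lsum ℕ fun i => ((φ i).f n).hom)
  comm' m n _ := by
    refine ModuleCat.hom_ext (DFinsupp.lhom_ext fun i x => ?_)
    have := LinearMap.congr_fun (congrArg ModuleCat.Hom.hom ((φ i).comm m n)) x
    have e : DFinsupp.lsum ℕ (fun i => ((φ i).f n).hom)
        ((DFinsupp.mapRange.linearMap fun i => ((K i).d m n).hom) (DFinsupp.single i x)) =
        ((φ i).f n).hom (((K i).d m n).hom x) := by
      simp
    have e' : C.d m n (DFinsupp.lsum ℕ (fun i => ((φ i).f m).hom) (DFinsupp.single i x)) =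
        C.d m n ((φ i).f m x) := by
      simp
    exact e'.trans (this.trans e.symm)

theorem ι_desc {C : CochainComplex (ModuleCat.{u} A) ℤ} (φ : ∀ i, K i ⟶ C) (i : I) :
    ι K i ≫ desc φ = φ i := by
  classical
  ext n x
  exact DFinsupp.sumAddHom_single (fun i => ((φ i).f n).hom.toAddMonoidHom) i x

theorem quotient_map_eq_zero {C : CochainComplex (ModuleCat.{u} A) ℤ} (f : directSum K ⟶ C)
    (hf : ∀ i, (HomotopyCategory.quotient (ModuleCat.{u} A) (ComplexShape.up ℤ)).map
      (ι K i ≫ f) = 0) :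
    (HomotopyCategory.quotient (ModuleCat.{u} A) (ComplexShape.up ℤ)).map f = 0 := by
  classical
  simp only [quotient_map_eq_zero_iff_exists] at hf ⊢
  choose s hs using hf
  refine ⟨fun n => ModuleCat.ofHom (DFinsupp.lsum ℕ fun i => (s i n).hom), fun n => ?_⟩
  refine ModuleCat.hom_ext (DFinsupp.lhom_ext fun i x => ?_)
  have := LinearMap.congr_fun (congrArg ModuleCat.Hom.hom (hs i n)) x
  have e : DFinsupp.lsum ℕ (fun i => (s i (n + 1)).hom)
      ((DFinsupp.mapRange.linearMap fun i => ((K i).d (n + 1) (n + 1 + 1)).hom)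
        (DFinsupp.single i x)) = s i (n + 1) ((K i).d (n + 1) (n + 1 + 1) x) := by
    simp
  have e' : C.d n (n + 1) (DFinsupp.lsum ℕ (fun i => (s i n).hom) (DFinsupp.single i x)) =
      C.d n (n + 1) (s i n x) := by
    simp
  exact this.trans (congrArg₂ (· + ·) e.symm e'.symm)

end directSum

/-- Direct sums of complexes as cofans in the homotopy category. -/
noncomputable def directSumCofan
    (X : I → HomotopyCategory (ModuleCat.{u} A) (ComplexShape.up ℤ)) : Cofan X :=
  Cofan.mk ((HomotopyCategory.quotient (ModuleCat.{u} A) (ComplexShape.up ℤ)).obj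
      (directSum fun i => (X i).as))
    fun i => (HomotopyCategory.quotient (ModuleCat.{u} A) (ComplexShape.up ℤ)).map
      (directSum.ι (fun i => (X i).as) i)

/-- Direct sums of complexes are coproducts in the homotopy category. -/
noncomputable def isColimitDirectSumCofan
    (X : I → HomotopyCategory (ModuleCat.{u} A) (ComplexShape.up ℤ)) :
    IsColimit (directSumCofan X) := by
  refine Cofan.IsColimit.mk _ (fun s => (HomotopyCategory.quotient (ModuleCat.{u} A)
    (ComplexShape.up ℤ)).map (directSum.desc fun i => Quot.out (s.inj i))) ?_ ?_
  · intro s i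
    refine ((HomotopyCategory.quotient (ModuleCat.{u} A) (ComplexShape.up ℤ)).map_comp _
      _).symm.trans ?_
    rw [directSum.ι_desc]
    exact HomotopyCategory.quotient_map_out _
  · intro s m hm
    obtain ⟨g, rfl⟩ := (HomotopyCategory.quotient (ModuleCat.{u} A)
      (ComplexShape.up ℤ)).map_surjective (X := directSum fun i => (X i).as) (Y := s.pt.as) m
    refine sub_eq_zero.1 ((Functor.map_sub _).symm.trans
      (directSum.quotient_map_eq_zero _ fun i => ?_))
    rw [Preadditive.comp_sub, Functor.map_sub, directSum.ι_desc, sub_eq_zero, Functor.map_comp]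
    exact (hm i).trans (HomotopyCategory.quotient_map_out _).symm

end Coproducts

section Compact

open CategoryTheory CategoryTheory.Limits

variable {A : Type u} [Ring A]

/-- A module viewed as a complex concentrated in degree `n`, up to homotopy. -/
noncomputable def stalk (M : ModuleCat.{u} A) (n : ℤ) :
    HomotopyCategory (ModuleCat.{u} A) (ComplexShape.up ℤ) :=
  (HomotopyCategory.quotient (ModuleCat.{u} A) (ComplexShape.up ℤ)).obj
    ((HomologicalComplex.single (ModuleCat.{u} A) (ComplexShape.up ℤ) n).obj M)

theorem single_eq_sum {I : Type u} {K : I → CochainComplex (ModuleCat.{u} A) ℤ}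
    (M : ModuleCat.{u} A) [Module.Finite A M] (n : ℤ)
    (φ : (HomologicalComplex.single (ModuleCat.{u} A) (ComplexShape.up ℤ) n).obj M ⟶
      directSum K) :
    ∃ J : Finset I, φ = ∑ j ∈ J, φ ≫ directSum.π K j ≫ directSum.ι K j := by
  classical
  have : Module.Finite A
      (((HomologicalComplex.single (ModuleCat.{u} A) (ComplexShape.up ℤ) n).obj M).X n) :=
    Module.Finite.equiv
      (HomologicalComplex.singleObjXSelf (ComplexShape.up ℤ) n M).toLinearEquiv.symm
  obtain ⟨s, hs⟩ := Module.Finite.fg_top (R := A)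
    (M := ((HomologicalComplex.single (ModuleCat.{u} A) (ComplexShape.up ℤ) n).obj M).X n)
  let φn : ((HomologicalComplex.single (ModuleCat.{u} A) (ComplexShape.up ℤ) n).obj M).X n →ₗ[A]
    Π₀ i, (K i).X n := (φ.f n).hom
  refine ⟨s.biUnion fun x => (φn x).support, ?_⟩
  simp only [← Preadditive.comp_sum]
  refine HomologicalComplex.hom_ext _ _ fun m => ?_
  by_cases hmn : m = n
  · subst hmn
    refine ModuleCat.hom_ext (LinearMap.ext_on hs fun x hx => ?_)
    refine (directSum.sum_apply _ (φn x) fun i hi => ?_).symm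
    exact Finset.mem_biUnion.2 ⟨x, hx, DFinsupp.mem_support_iff.2 hi⟩
  · exact (HomologicalComplex.isZero_single_obj_X _ _ _ _ hmn).eq_of_src _ _

theorem stalk_hom_eq_sum {I : Type u}
    (X : I → HomotopyCategory (ModuleCat.{u} A) (ComplexShape.up ℤ)) (c : Cofan X)
    (hc : IsColimit c) (M : ModuleCat.{u} A) [Module.Finite A M] (n : ℤ) (f : stalk M n ⟶ c.pt) :
    ∃ (J : Finset I) (g : ∀ i, stalk M n ⟶ X i), f = ∑ j ∈ J, g j ≫ c.inj j := by
  let c' := directSumCofan X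
  let e := hc.coconePointUniqueUpToIso (isColimitDirectSumCofan X)
  have he (i : I) : c'.inj i ≫ e.inv = c.inj i :=
    hc.comp_coconePointUniqueUpToIso_inv (isColimitDirectSumCofan X) ⟨i⟩
  obtain ⟨φ, hφ⟩ := (HomotopyCategory.quotient (ModuleCat.{u} A) (ComplexShape.up ℤ)).map_surjective
    (X := (HomologicalComplex.single (ModuleCat.{u} A) (ComplexShape.up ℤ) n).obj M)
    (Y := directSum fun i => (X i).as) (f ≫ e.hom)
  obtain ⟨J, hJ⟩ := single_eq_sum M n φ
  have h : ∃ g : ∀ i, stalk M n ⟶ X i, f ≫ e.hom = ∑ j ∈ J, g j ≫ c'.inj j := by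
    refine ⟨fun i => (HomotopyCategory.quotient (ModuleCat.{u} A) (ComplexShape.up ℤ)).map
      (φ ≫ directSum.π _ i), hφ.symm.trans ?_⟩
    conv_lhs => rw [hJ, Functor.map_sum]
    refine Finset.sum_congr rfl fun j _ => ?_
    rw [← Category.assoc, Functor.map_comp]
    rfl
  obtain ⟨g, hg⟩ := h
  refine ⟨J, g, ?_⟩
  rw [← cancel_mono e.hom, hg, Preadditive.sum_comp]
  refine Finset.sum_congr rfl fun j _ => ?_
  rw [Category.assoc, ← he, Category.assoc, e.inv_hom_id, Category.comp_id]

theorem isKappaSmall_stalk (M : ModuleCat.{u} A) [Module.Finite A M] (n : ℤ) :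
    IsKappaSmall (HomotopyCategory (ModuleCat.{u} A) (ComplexShape.up ℤ)) Set.univ
      Cardinal.aleph0.{u} (stalk M n) := by
  intro I X _ c hc f
  obtain ⟨J, g, rfl⟩ := stalk_hom_eq_sum X c hc M n f
  let c' := directSumCofan fun j : (J : Set I) => X j
  refine ⟨J, c', isColimitDirectSumCofan _, ∑ j : (J : Set I), g j ≫ c'.inj j,
    Cardinal.lt_aleph0_of_finite _, ?_⟩
  have h (j : (J : Set I)) : c'.inj j ≫ (isColimitDirectSumCofan fun j : (J : Set I) => X j).desc
      (Cofan.mk c.pt fun j : (J : Set I) => c.inj j.1) = c.inj j.1 :=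
    (isColimitDirectSumCofan fun j : (J : Set I) => X j).fac _ ⟨j⟩
  rw [Preadditive.sum_comp]
  simp only [Category.assoc, h]
  exact (Finset.sum_coe_sort J fun j => g j ≫ c.inj j).symm

theorem factorsThroughFamily_stalk
    (S : Set (HomotopyCategory (ModuleCat.{u} A) (ComplexShape.up ℤ)))
    (M : ModuleCat.{u} A) [Module.Finite A M] (n : ℤ) (hS : stalk M n ∈ S) :
    FactorsThroughFamily (HomotopyCategory (ModuleCat.{u} A) (ComplexShape.up ℤ)) Set.univ S
      (stalk M n) := by
  intro I X _ c hc f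
  obtain ⟨J, g, rfl⟩ := stalk_hom_eq_sum X c hc M n f
  let c' := directSumCofan fun _ : I => stalk M n
  refine ⟨fun _ => stalk M n, fun _ => hS, g, c', isColimitDirectSumCofan _,
    ∑ j ∈ J, c'.inj j, ?_⟩
  rw [Preadditive.sum_comp]
  exact Finset.sum_congr rfl fun j _ =>
    ((isColimitDirectSumCofan fun _ : I => stalk M n).fac
      (Cofan.mk c.pt fun i => g i ≫ c.inj i) ⟨j⟩).symm

end Compact

section Contraction

open CategoryTheory CategoryTheory.Limits

variable {A : Type u} [Ring A]

/-- A complex is contractible if its differentials admit sections over the cycles. -/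
theorem quotient_map_id_eq_zero_of_sections (C : CochainComplex (ModuleCat.{u} A) ℤ)
    (σ : ∀ n : ℤ, LinearMap.ker (C.d (n + 1) (n + 1 + 1)).hom →ₗ[A] C.X n)
    (hσ : ∀ n z, C.d n (n + 1) (σ n z) = z.1) :
    (HomotopyCategory.quotient (ModuleCat.{u} A) (ComplexShape.up ℤ)).map (𝟙 C) = 0 := by
  have hd (n : ℤ) (x : C.X n) : C.d (n + 1) (n + 1 + 1) (C.d n (n + 1) x) = 0 :=
    LinearMap.congr_fun (congrArg ModuleCat.Hom.hom (C.d_comp_d n (n + 1) (n + 1 + 1))) x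
  let δ (n : ℤ) : C.X n →ₗ[A] LinearMap.ker (C.d (n + 1) (n + 1 + 1)).hom :=
    LinearMap.codRestrict _ (C.d n (n + 1)).hom (hd n)
  let ρ (n : ℤ) : C.X (n + 1) →ₗ[A] LinearMap.ker (C.d (n + 1) (n + 1 + 1)).hom :=
    LinearMap.codRestrict _ (LinearMap.id - σ (n + 1) ∘ₗ δ (n + 1)) fun x => by
      have := hσ (n + 1) (δ (n + 1) x)
      refine LinearMap.mem_ker.2 ((map_sub _ _ _).trans (sub_eq_zero.2 this.symm))
  refine (quotient_map_eq_zero_iff_exists _).2 ⟨fun n => ModuleCat.ofHom (σ n ∘ₗ ρ n), fun n => ?_⟩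
  refine ModuleCat.hom_ext (LinearMap.ext fun x => ?_)
  have h₁ : C.d n (n + 1) (σ n (ρ n x)) = x - σ (n + 1) (δ (n + 1) x) := hσ n _
  have h₂ : ρ (n + 1) (C.d (n + 1) (n + 1 + 1) x) = δ (n + 1) x := by
    refine Subtype.ext ?_
    have : δ (n + 1 + 1) (C.d (n + 1) (n + 1 + 1) x) = 0 := Subtype.ext (hd (n + 1) x)
    change _ - σ (n + 1 + 1) (δ (n + 1 + 1) (C.d (n + 1) (n + 1 + 1) x)) = _
    rw [this, map_zero, sub_zero]
    rfl
  change x = σ (n + 1) (ρ (n + 1) (C.d (n + 1) (n + 1 + 1) x)) + C.d n (n + 1) (σ n (ρ n x))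
  rw [h₁, h₂, add_sub_cancel]

/-- Maps from a module to the cycles lift along the differential if the corresponding stalk
complex has only null-homotopic maps. -/
theorem exists_lift_of_stalk_hom_eq_zero
    (C : HomotopyCategory (ModuleCat.{u} A) (ComplexShape.up ℤ)) (n : ℤ) (M : ModuleCat.{u} A)
    (hM : ∀ f : stalk M (n + 1) ⟶ C, f = 0)
    (g : M →ₗ[A] LinearMap.ker (C.as.d (n + 1) (n + 1 + 1)).hom) :
    ∃ g' : M →ₗ[A] C.as.X n, ∀ x, C.as.d n (n + 1) (g' x) = (g x).1 := by
  let φ : M ⟶ C.as.X (n + 1) := ModuleCat.ofHom (Submodule.subtype _ ∘ₗ g)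
  have hφ : ∀ k : ℤ, (ComplexShape.up ℤ).Rel (n + 1) k → φ ≫ C.as.d (n + 1) k = 0 := by
    rintro k rfl
    exact ModuleCat.hom_ext (LinearMap.ext fun x => (g x).2)
  obtain ⟨s, hs⟩ := (quotient_map_eq_zero_iff_exists _).1
    (hM ((HomotopyCategory.quotient (ModuleCat.{u} A) (ComplexShape.up ℤ)).map
      (HomologicalComplex.mkHomFromSingle φ hφ)))
  have h := hs n
  rw [HomologicalComplex.mkHomFromSingle_f, HomologicalComplex.single_obj_d, zero_comp,
    zero_add] at h
  refine ⟨((HomologicalComplex.singleObjXSelf (ComplexShape.up ℤ) (n + 1) M).inv ≫ s n).hom,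
    fun x => ?_⟩
  have h' : φ = (HomologicalComplex.singleObjXSelf (ComplexShape.up ℤ) (n + 1) M).inv ≫ s n ≫
      C.as.d n (n + 1) := by
    rw [← h, Iso.inv_hom_id_assoc]
  exact (LinearMap.congr_fun (congrArg ModuleCat.Hom.hom h') x).symm

/-- The stalk complexes of finitely generated modules. -/
def finiteStalks (A : Type u) [Ring A] :
    Set (HomotopyCategory (ModuleCat.{u} A) (ComplexShape.up ℤ)) :=
  Set.range fun p : (Σ m : ℕ, Submodule A (Fin m → A)) × ℤ =>
    stalk (ModuleCat.of A ((Fin p.1.1 → A) ⧸ p.1.2)) p.2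

theorem generatesWell_finiteStalks [IsArtinianRing A]
    (hret : ∀ (Z : Type u) [AddCommGroup Z] [Module A Z] [Nontrivial Z],
      ∃ (L : Type u) (_ : AddCommGroup L) (_ : Module A L) (i : L →ₗ[A] Z) (r : Z →ₗ[A] L),
        Module.Finite A L ∧ Nontrivial L ∧ r ∘ₗ i = LinearMap.id) :
    GeneratesWell (HomotopyCategory (ModuleCat.{u} A) (ComplexShape.up ℤ)) Set.univ
      Cardinal.aleph0.{u} (finiteStalks A) where
  subset := Set.subset_univ _
  isSmall := small_range _
  kappaSmall := by
    rintro _ ⟨p, rfl⟩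
    exact isKappaSmall_stalk _ _
  factors := by
    rintro _ ⟨p, rfl⟩
    exact factorsThroughFamily_stalk (finiteStalks A) _ _ (Set.mem_range_self p)
  nondegenerate C _ hC := by
    have hd (n : ℤ) (x : C.as.X n) : C.as.d (n + 1) (n + 1 + 1) (C.as.d n (n + 1) x) = 0 :=
      LinearMap.congr_fun (congrArg ModuleCat.Hom.hom (C.as.d_comp_d n (n + 1) (n + 1 + 1))) x
    have key (n : ℤ) : ∃ σ : LinearMap.ker (C.as.d (n + 1) (n + 1 + 1)).hom →ₗ[A] C.as.X n,
        ∀ z, C.as.d n (n + 1) (σ z) = z.1 := by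
      obtain ⟨σ, hσ⟩ := exists_section_of_finite_lifting hret
        (LinearMap.codRestrict (LinearMap.ker (C.as.d (n + 1) (n + 1 + 1)).hom)
          (C.as.d n (n + 1)).hom (hd n)) fun B _ _ _ h => by
        obtain ⟨m, q, hq⟩ := Module.Finite.exists_fin' A B
        let e := q.quotKerEquivOfSurjective hq
        obtain ⟨g, hg⟩ := exists_lift_of_stalk_hom_eq_zero C n
          (ModuleCat.of A ((Fin m → A) ⧸ LinearMap.ker q))
          (hC (stalk (ModuleCat.of A ((Fin m → A) ⧸ LinearMap.ker q)) (n + 1))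
            ⟨(⟨m, LinearMap.ker q⟩, n + 1), rfl⟩) (h ∘ₗ e.toLinearMap)
        refine ⟨g ∘ₗ e.symm.toLinearMap, LinearMap.ext fun x => Subtype.ext ?_⟩
        refine (hg (e.symm x)).trans ?_
        simp
      exact ⟨σ, fun z => congrArg Subtype.val (LinearMap.congr_fun hσ z)⟩
    choose σ hσ using key
    refine (IsZero.iff_id_eq_zero _).2 ?_
    have := quotient_map_id_eq_zero_of_sections C.as σ hσ
    rw [CategoryTheory.Functor.map_id] at this
    exact this

end Contraction

section Main

open CategoryTheory CategoryTheory.Limits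

/-- The equivalence for algebras which are finite over an artinian commutative ring, in terms of
left modules. -/
theorem wellGenerated_iff_finite_type {k : Type u} [CommRing k] [IsArtinianRing k]
    {A : Type u} [Ring A] [Algebra k A] [Module.Finite k A] :
    IsWellGenerated (HomotopyCategory (ModuleCat.{u} A) (ComplexShape.up ℤ)) ↔
      ∃ (n : ℕ) (M : Fin n → ModuleCat.{u} A), ∀ N : ModuleCat.{u} A, Module.Finite A N →
        IsIndecomposableModule A N → ∃ i, Nonempty (N ≅ M i) := by
  have : IsArtinianRing A := isArtinian_of_tower k inferInstance
  have hlas : ∀ (L : Type u) [AddCommGroup L] [Module A L] [Module.Finite A L],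
      IsIndecomposableModule A L → ∃ (E : Type u) (_ : AddCommGroup E) (_ : Module A E)
        (a : L →ₗ[A] E), Module.Finite A E ∧ IsLeftAlmostSplit a :=
    fun L _ _ _ hL => exists_isLeftAlmostSplit (k := k) hL
  constructor
  · rintro ⟨κ, -, S, hS⟩
    obtain ⟨X, _, _, hX⟩ := exists_module_retract_of_nondegenerate hS.isSmall
      fun X h => hS.nondegenerate X (Set.mem_univ X) h
    exact finite_type_of_wellFounded (PointedModule.wellFounded_lt_of_retract hX) hlas
  · intro h
    have hwf := PointedModule.wellFounded_lt_of_finite k h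
    exact ⟨_, Cardinal.isRegular_aleph0, _, generatesWell_finiteStalks
      fun Z _ _ _ => exists_finite_retract hwf hlas Z⟩

end Main

end LocWellGen

namespace LocWellGen

open CategoryTheory CategoryTheory.Limits

universe u

/-- if `R` is an artin algebra (finitely generated as a module over its
artinian center), then `K(Mod-R)` is well generated iff `R` has finite representation
type. -/
theorem homotopyCategory_wellGenerated_iff_finite_representation_type
    (R : Type u) [Ring R]
    (hart : IsArtinianRing (Subring.center R))
    (hfin : Module.Finite (Subring.center R) R) :
    IsWellGenerated (HomotopyCategory (ModuleCat.{u} Rᵐᵒᵖ) (ComplexShape.up ℤ)) ↔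
      HasFiniteRepresentationType R := by
  have : Module.Finite (Subring.center R) Rᵐᵒᵖ :=
    Module.Finite.equiv (MulOpposite.opLinearEquiv (Subring.center R))
  exact wellGenerated_iff_finite_type (k := Subring.center R)

end LocWellGen
end

section
/- Let T be a well generated triangulated category and S ⊆ T a set of objects. Then the localizing subcategory Loc(S) generated by S is itself a well generated triangulated category. -/
namespace LocWellGen

open CategoryTheory CategoryTheory.Limits CategoryTheory.Pretriangulated

universe v u

section Triangles

variable {T : Type u} [Category.{v} T] [HasZeroObject T] [HasShift T ℤ] [Preadditive T]
  [∀ n : ℤ, (shiftFunctor T n).Additive] [Pretriangulated T]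

section

variable {X Y Z : T} {f : X ⟶ Y} {g : Y ⟶ Z} {h : Z ⟶ X⟦(1 : ℤ)⟧}
  (hD : Triangle.mk f g h ∈ distTriang T)

include hD

lemma distTriang_comp₁₂ : f ≫ g = 0 :=
  comp_distTriang_mor_zero₁₂ _ hD

lemma distTriang_comp₂₃ : g ≫ h = 0 :=
  comp_distTriang_mor_zero₂₃ _ hD

lemma distTriang_lift₂ {A : T} (k : A ⟶ Y) (hk : k ≫ g = 0) : ∃ l : A ⟶ X, k = l ≫ f :=
  Triangle.coyoneda_exact₂ _ hD k hk

lemma distTriang_lift₃ {A : T} (k : A ⟶ Z) (hk : k ≫ h = 0) : ∃ l : A ⟶ Y, k = l ≫ g :=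
  Triangle.coyoneda_exact₃ _ hD k hk

lemma distTriang_desc₂ {A : T} (k : Y ⟶ A) (hk : f ≫ k = 0) : ∃ l : Z ⟶ A, k = g ≫ l :=
  Triangle.yoneda_exact₂ _ hD k hk

lemma distTriang_rotate : Triangle.mk g h (-f⟦(1 : ℤ)⟧') ∈ distTriang T :=
  rot_of_distTriang _ hD

variable {X' Y' Z' : T} {f' : X' ⟶ Y'} {g' : Y' ⟶ Z'} {h' : Z' ⟶ X'⟦(1 : ℤ)⟧}
  (hD' : Triangle.mk f' g' h' ∈ distTriang T)

include hD'

lemma distTriang_map₃ (a : X ⟶ X') (b : Y ⟶ Y') (comm : f ≫ b = a ≫ f') :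
    ∃ c : Z ⟶ Z', g ≫ c = b ≫ g' ∧ h ≫ a⟦(1 : ℤ)⟧' = c ≫ h' :=
  complete_distinguished_triangle_morphism _ _ hD hD' a b comm

end

lemma distTriang_map₂ {X Y Z Y' Z' : T} {f : X ⟶ Y} {g : Y ⟶ Z} {h : Z ⟶ X⟦(1 : ℤ)⟧}
    (hD : Triangle.mk f g h ∈ distTriang T) {f' : X ⟶ Y'} {g' : Y' ⟶ Z'}
    {h' : Z' ⟶ X⟦(1 : ℤ)⟧} (hD' : Triangle.mk f' g' h' ∈ distTriang T) (c : Z ⟶ Z')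
    (comm : h = c ≫ h') : ∃ b : Y ⟶ Y', f ≫ b = f' ∧ g ≫ c = b ≫ g' := by
  have comm' : h ≫ (𝟙 X)⟦(1 : ℤ)⟧' = c ≫ h' := by
    rw [CategoryTheory.Functor.map_id, Category.comp_id, comm]
  obtain ⟨b, hb₁, hb₂⟩ := complete_distinguished_triangle_morphism₂ _ _ hD hD' (𝟙 X) c comm'
  exact ⟨b, hb₁.trans (Category.id_comp f'), hb₂⟩

end Triangles

section Cut

variable {T : Type u} [Category.{v} T] [Preadditive T]

open Classical in
/-- The endomorphism of a coproduct which is the identity on the summands indexed by `J` and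
zero on the other summands. -/
noncomputable def cut {I : Type v} {X : I → T} {c : Cofan X} (hc : IsColimit c) (J : Set I) :
    c.pt ⟶ c.pt :=
  Cofan.IsColimit.desc hc fun i => if i ∈ J then c.inj i else 0

lemma inj_cut_of_mem {I : Type v} {X : I → T} {c : Cofan X} (hc : IsColimit c) {J : Set I}
    {i : I} (hi : i ∈ J) : c.inj i ≫ cut hc J = c.inj i := by
  simp [cut, hi]

lemma inj_cut_of_notMem {I : Type v} {X : I → T} {c : Cofan X} (hc : IsColimit c) {J : Set I}
    {i : I} (hi : i ∉ J) : c.inj i ≫ cut hc J = 0 := by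
  simp [cut, hi]

lemma cut_comp_cut_of_subset {I : Type v} {X : I → T} {c : Cofan X} (hc : IsColimit c)
    {J K : Set I} (h : J ⊆ K) : cut hc J ≫ cut hc K = cut hc J := by
  refine Cofan.IsColimit.hom_ext hc _ _ fun i => ?_
  by_cases hi : i ∈ J
  · rw [← Category.assoc, inj_cut_of_mem hc hi, inj_cut_of_mem hc (h hi)]
  · rw [← Category.assoc, inj_cut_of_notMem hc hi, zero_comp]

lemma cut_union {I : Type v} {X : I → T} {c : Cofan X} (hc : IsColimit c) (J K : Set I) :
    cut hc (J ∪ K) = cut hc J + cut hc K - cut hc J ≫ cut hc K := by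
  refine Cofan.IsColimit.hom_ext hc _ _ fun i => ?_
  by_cases hi : i ∈ J <;> by_cases hi' : i ∈ K <;> simp [cut, hi, hi']

/-- A reformulation of smallness: every morphism to a coproduct is unchanged by composition with
the projection onto a subcoproduct over fewer than `κ` indices. -/
def IsCutSmall (κ : Cardinal.{v}) (Y : T) : Prop :=
  ∀ {I : Type v} (X : I → T) (c : Cofan X) (hc : IsColimit c) (f : Y ⟶ c.pt),
    ∃ J : Set I, Cardinal.mk J < κ ∧ f ≫ cut hc J = f

lemma IsKappaSmall.isCutSmall {κ : Cardinal.{v}} {Y : T} (h : IsKappaSmall T Set.univ κ Y) :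
    IsCutSmall κ Y := by
  intro I X c hc f
  obtain ⟨J, c', hc', g, hJ, rfl⟩ := h X (fun _ => trivial) c hc f
  refine ⟨J, hJ, ?_⟩
  rw [Category.assoc]
  congr 1
  refine Cofan.IsColimit.hom_ext hc' _ _ fun j => ?_
  simp [inj_cut_of_mem hc j.2]

lemma IsCutSmall.isKappaSmall [HasCoproducts.{v} T] {κ : Cardinal.{v}} {Y : T}
    (h : IsCutSmall κ Y) (L : Set T) : IsKappaSmall T L κ Y := by
  classical
  intro I X _ c hc f
  obtain ⟨J, hJ, hf⟩ := h X c hc f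
  refine ⟨J, _, coproductIsCoproduct fun j : J => X j, f ≫ Cofan.IsColimit.desc hc
    (fun i => if hi : i ∈ J then Sigma.ι (fun j : J => X j) ⟨i, hi⟩ else 0), hJ, ?_⟩
  rw [← hf, Category.assoc, Category.assoc]
  congr 1
  refine Cofan.IsColimit.hom_ext hc _ _ fun i => ?_
  by_cases hi : i ∈ J
  · simpa [reassoc_of% inj_cut_of_mem hc hi, inj_cut_of_mem hc hi, hi] using
      (Cofan.IsColimit.inj_desc (Cofan.mk c.pt fun j : J => c.inj j.1)
        (coproductIsCoproduct fun j : J => X j) ⟨i, hi⟩).symm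
  · simp [reassoc_of% inj_cut_of_notMem hc hi, inj_cut_of_notMem hc hi]

end Cut

section CardLocalizing

variable {T : Type u} [Category.{v} T] [HasZeroObject T] [HasShift T ℤ] [Preadditive T]
  [∀ n : ℤ, (shiftFunctor T n).Additive] [Pretriangulated T]

/-- A class of objects closed under shifts, extensions and coproducts of fewer than `κ`
objects. -/
structure IsCardLocalizing (κ : Cardinal.{v}) (A : Set T) : Prop where
  shift : ∀ (X : T) (n : ℤ), X ∈ A → X⟦n⟧ ∈ A
  ext₂ : ∀ D ∈ distTriang T, D.obj₁ ∈ A → D.obj₃ ∈ A → D.obj₂ ∈ A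
  coproduct : ∀ {I : Type v} (X : I → T), Cardinal.mk I < κ → (∀ i, X i ∈ A) →
    ∀ (c : Cofan X), IsColimit c → c.pt ∈ A

/-- The smallest `κ`-localizing class of objects containing `S`. -/
def cardLoc (κ : Cardinal.{v}) (S : Set T) : Set T :=
  ⋂₀ {A : Set T | IsCardLocalizing κ A ∧ S ⊆ A}

lemma subset_cardLoc (κ : Cardinal.{v}) (S : Set T) : S ⊆ cardLoc κ S :=
  Set.subset_sInter fun _ hA => hA.2

lemma cardLoc_subset {κ : Cardinal.{v}} {S A : Set T} (hA : IsCardLocalizing κ A) (h : S ⊆ A) :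
    cardLoc κ S ⊆ A :=
  Set.sInter_subset_of_mem ⟨hA, h⟩

lemma isCardLocalizing_cardLoc (κ : Cardinal.{v}) (S : Set T) :
    IsCardLocalizing κ (cardLoc κ S) where
  shift X n hX A hA := hA.1.shift X n (hX A hA)
  ext₂ D hD h₁ h₃ A hA := hA.1.ext₂ D hD (h₁ A hA) (h₃ A hA)
  coproduct X hI hX c hc A hA := hA.1.coproduct X hI (fun i => hX i A hA) c hc

lemma IsLocalizing.isCardLocalizing {L : Set T} (hL : IsLocalizing T L) (κ : Cardinal.{v}) :
    IsCardLocalizing κ L where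
  shift := hL.shiftClosed
  ext₂ := hL.ext₂
  coproduct X _ hX c hc := hL.coproductClosed X hX c hc

lemma IsCardLocalizing.mono {κ κ' : Cardinal.{v}} {A : Set T} (hA : IsCardLocalizing κ' A)
    (h : κ ≤ κ') : IsCardLocalizing κ A where
  shift := hA.shift
  ext₂ := hA.ext₂
  coproduct X hI hX c hc := hA.coproduct X (hI.trans_le h) hX c hc

lemma cardLoc_mono {κ κ' : Cardinal.{v}} (h : κ ≤ κ') (S : Set T) :
    cardLoc κ S ⊆ cardLoc κ' S :=
  cardLoc_subset ((isCardLocalizing_cardLoc κ' S).mono h) (subset_cardLoc κ' S)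

lemma isLocalizing_loc (S : Set T) : IsLocalizing T (Loc T S) where
  zero _ hA := hA.1.zero
  isoClosed e hX _ hA := hA.1.isoClosed e (hX _ hA)
  shiftClosed X n hX A hA := hA.1.shiftClosed X n (hX A hA)
  ext₂ D hD h₁ h₃ A hA := hA.1.ext₂ D hD (h₁ A hA) (h₃ A hA)
  coproductClosed X hX c hc A hA := hA.1.coproductClosed X (fun i => hX i A hA) c hc

lemma loc_subset {S L : Set T} (hL : IsLocalizing T L) (h : S ⊆ L) : Loc T S ⊆ L :=
  Set.sInter_subset_of_mem ⟨hL, h⟩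

lemma cardLoc_subset_loc (κ : Cardinal.{v}) (S : Set T) : cardLoc κ S ⊆ Loc T S :=
  cardLoc_subset ((isLocalizing_loc S).isCardLocalizing κ) (Set.subset_sInter fun _ hA => hA.2)

namespace IsCardLocalizing

variable {κ : Cardinal.{v}} {A : Set T}

lemma iso (hA : IsCardLocalizing κ A) (hκ : κ.IsRegular) {X Y : T} (e : X ≅ Y) (hX : X ∈ A) :
    Y ∈ A :=
  hA.coproduct (fun _ : PUnit.{v + 1} => X) (by simpa using hκ.nat_lt 1) (fun _ => hX)
    (Cofan.mk Y fun _ => e.hom)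
    (Cofan.IsColimit.mk _ (fun t => e.inv ≫ t.inj PUnit.unit)
      (fun t j => by simp) (fun t m hm => by simp [← hm]))

lemma biprod_mem (hA : IsCardLocalizing κ A) {X Y : T} (hX : X ∈ A) (hY : Y ∈ A) : (X ⊞ Y) ∈ A :=
  hA.ext₂ _ (binaryBiproductTriangle_distinguished X Y) hX hY

lemma fiber (hA : IsCardLocalizing κ A) {X Y Z : T} {f : X ⟶ Y} {g : Y ⟶ Z}
    {h : Z ⟶ X⟦(1 : ℤ)⟧} (hD : Triangle.mk f g h ∈ distTriang T) (hY : Y ∈ A) (hZ : Z ∈ A) :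
    X ∈ A :=
  hA.ext₂ _ (inv_rot_of_distTriang _ hD) (hA.shift Z (-1) hZ) hY

lemma cofiber (hA : IsCardLocalizing κ A) {X Y Z : T} {f : X ⟶ Y} {g : Y ⟶ Z}
    {h : Z ⟶ X⟦(1 : ℤ)⟧} (hD : Triangle.mk f g h ∈ distTriang T) (hX : X ∈ A) (hY : Y ∈ A) :
    Z ∈ A :=
  hA.ext₂ _ (rot_of_distTriang _ hD) hY (hA.shift X 1 hX)

lemma exists_fiber (hA : IsCardLocalizing κ A) {X Z : T} (h : Z ⟶ X⟦(1 : ℤ)⟧)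
    (hX : X ∈ A) (hZ : Z ∈ A) :
    ∃ (Y : T) (f : X ⟶ Y) (g : Y ⟶ Z), Y ∈ A ∧ Triangle.mk f g h ∈ distTriang T := by
  obtain ⟨Y, f, g, hD⟩ := distinguished_cocone_triangle₂ h
  exact ⟨Y, f, g, hA.ext₂ _ hD hX hZ, hD⟩

end IsCardLocalizing

section Small

/-- The shift of a colimit cofan is a colimit cofan. -/
noncomputable def isColimitShift {I : Type v} {X : I → T} {c : Cofan X} (hc : IsColimit c)
    (n : ℤ) : IsColimit (Cofan.mk (c.pt⟦n⟧) fun i => (c.inj i)⟦n⟧') :=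
  isColimitCofanMkObjOfIsColimit (shiftFunctor T n) X _
    (IsColimit.ofIsoColimit hc (Cofan.ext (Iso.refl _) (by simp)))

lemma isCardLocalizing_isCutSmall {κ : Cardinal.{v}} (hκ : κ.IsRegular) :
    IsCardLocalizing κ {Y : T | IsCutSmall κ Y} where
  shift Y n hY := by
    intro I X c hc f
    obtain ⟨J, hJ, h⟩ := hY _ _ (isColimitShift hc (-n)) ((shiftShiftNeg Y n).inv ≫ f⟦-n⟧')
    refine ⟨J, hJ, (shiftFunctor T (-n)).map_injective ?_⟩
    rw [Category.assoc, cancel_epi] at h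
    rw [Functor.map_comp]
    suffices (cut hc J)⟦-n⟧' = cut (isColimitShift hc (-n)) J by rwa [this]
    refine Cofan.IsColimit.hom_ext (isColimitShift hc (-n)) _ _ fun i => ?_
    by_cases hi : i ∈ J
    · rw [inj_cut_of_mem _ hi]
      simp [← Functor.map_comp, inj_cut_of_mem _ hi]
    · rw [inj_cut_of_notMem _ hi]
      simp [← Functor.map_comp, inj_cut_of_notMem _ hi]
  ext₂ D hD h₁ h₃ := by
    intro I X c hc f
    obtain ⟨J, hJ, h⟩ := h₁ X c hc (D.mor₁ ≫ f)
    obtain ⟨g, hg⟩ := D.yoneda_exact₂ hD (f - f ≫ cut hc J) (by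
      rw [Preadditive.comp_sub, ← Category.assoc, h, sub_self])
    obtain ⟨K, hK, h'⟩ := h₃ X c hc g
    refine ⟨J ∪ K, (Cardinal.mk_union_le J K).trans_lt
      (Cardinal.add_lt_of_lt hκ.aleph0_le hJ hK), ?_⟩
    have : (f - f ≫ cut hc J) ≫ cut hc K = f - f ≫ cut hc J := by
      rw [hg, Category.assoc, h']
    rw [cut_union]
    simp only [Preadditive.sub_comp, Preadditive.comp_add, Preadditive.comp_sub,
      Category.assoc] at this ⊢
    rw [add_sub_assoc, this]
    abel
  coproduct {K} Y hK hY d hd := by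
    intro I X c hc f
    choose J hJ h using fun k => hY k X c hc (d.inj k ≫ f)
    refine ⟨⋃ k, J k, (Cardinal.card_iUnion_lt_iff_forall_of_isRegular hκ hK).2 hJ, ?_⟩
    refine Cofan.IsColimit.hom_ext hd _ _ fun k => ?_
    rw [← Category.assoc, ← h k, Category.assoc,
      cut_comp_cut_of_subset hc (Set.subset_iUnion J k)]

end Small

section Coproducts

variable [HasCoproducts.{v} T]

/-- Exactness of a coproduct of distinguished triangles in the middle term. -/
lemma exists_lift_coproduct {I : Type v} {X Y Z : I → T} {u : ∀ i, X i ⟶ Y i}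
    {w : ∀ i, Y i ⟶ Z i} {t : ∀ i, Z i ⟶ (X i)⟦(1 : ℤ)⟧}
    (hD : ∀ i, Triangle.mk (u i) (w i) (t i) ∈ distTriang T)
    {c : Cofan Y} (hc : IsColimit c) {A : T} (f : A ⟶ c.pt)
    (hf : f ≫ Cofan.IsColimit.desc hc (fun i => w i ≫ Sigma.ι Z i) = 0) :
    ∃ g : A ⟶ ∐ X, f = g ≫ Sigma.desc (fun i => u i ≫ c.inj i) := by
  obtain ⟨C, p, q, hC⟩ :=
    distinguished_cocone_triangle (Sigma.desc (fun i => u i ≫ c.inj i) : ∐ X ⟶ c.pt)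
  have h : ∀ i, ∃ r : Z i ⟶ C, w i ≫ r = c.inj i ≫ p := fun i => by
    obtain ⟨r, hr, -⟩ := distTriang_map₃ (hD i) hC (Sigma.ι X i) (c.inj i)
      (by simp)
    exact ⟨r, hr⟩
  choose r hr using h
  refine distTriang_lift₂ hC f ?_
  have : p = Cofan.IsColimit.desc hc (fun i => w i ≫ Sigma.ι Z i) ≫ Sigma.desc r := by
    refine Cofan.IsColimit.hom_ext hc _ _ fun i => ?_
    simp [hr]
  rw [this, reassoc_of% hf, zero_comp]

omit [HasZeroObject T] [HasShift T ℤ] [Preadditive T] [∀ n : ℤ, (shiftFunctor T n).Additive]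
  [Pretriangulated T] in
lemma FactorsThroughFamily.exists_sigma {A : Set T} {Y : T}
    (h : FactorsThroughFamily T Set.univ A Y) {I : Type v} {X : I → T} {c : Cofan X}
    (hc : IsColimit c) (f : Y ⟶ c.pt) :
    ∃ (Z : I → T) (φ : ∀ i, Z i ⟶ X i) (g : Y ⟶ ∐ Z), (∀ i, Z i ∈ A) ∧
      f = g ≫ Sigma.desc (fun i => φ i ≫ c.inj i) := by
  obtain ⟨Z, hZ, φ, cz, hcz, g, rfl⟩ := h X (fun _ => trivial) c hc f
  refine ⟨Z, φ, g ≫ Cofan.IsColimit.desc hcz (Sigma.ι Z), hZ, ?_⟩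
  rw [Category.assoc]
  congr 1
  refine Cofan.IsColimit.hom_ext hcz _ _ fun i => ?_
  simp

omit [HasZeroObject T] [HasShift T ℤ] [Preadditive T] [∀ n : ℤ, (shiftFunctor T n).Additive]
  [Pretriangulated T] in
lemma factorsThroughFamily_of_sigma {L A : Set T} {Y : T}
    (h : ∀ {I : Type v} (X : I → T), (∀ i, X i ∈ L) → ∀ (c : Cofan X) (_ : IsColimit c)
      (f : Y ⟶ c.pt), ∃ (Z : I → T) (φ : ∀ i, Z i ⟶ X i) (g : Y ⟶ ∐ Z), (∀ i, Z i ∈ A) ∧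
      f = g ≫ Sigma.desc (fun i => φ i ≫ c.inj i)) :
    FactorsThroughFamily T L A Y := by
  intro I X hX c hc f
  obtain ⟨Z, φ, g, hZ, rfl⟩ := h X hX c hc f
  refine ⟨Z, hZ, φ, _, coproductIsCoproduct Z, g, ?_⟩
  congr 1
  refine Sigma.hom_ext _ _ fun i => ?_
  simpa using (Cofan.IsColimit.inj_desc (Cofan.mk c.pt fun i => φ i ≫ c.inj i)
    (coproductIsCoproduct Z) i).symm

lemma isCardLocalizing_factorsThroughFamily {κ : Cardinal.{v}} {A : Set T}
    (hA : IsCardLocalizing κ A) :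
    IsCardLocalizing κ {Y : T | FactorsThroughFamily T Set.univ A Y} where
  shift Y n hY := by
    refine factorsThroughFamily_of_sigma fun {I} X _ c hc f => ?_
    obtain ⟨f', hf'⟩ := (shiftFunctor T n).map_surjective (f ≫ (shiftNegShift c.pt n).inv)
    obtain ⟨Z, φ, g, hZ, hg⟩ := hY.exists_sigma (isColimitShift hc (-n)) f'
    refine ⟨fun i => (Z i)⟦n⟧, fun i => (φ i)⟦n⟧' ≫ (shiftNegShift (X i) n).hom,
      g⟦n⟧' ≫ Cofan.IsColimit.desc (isColimitShift (coproductIsCoproduct Z) n)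
        (Sigma.ι fun i => (Z i)⟦n⟧), fun i => hA.shift _ _ (hZ i), ?_⟩
    rw [← cancel_mono (shiftNegShift c.pt n).inv, ← hf', hg, Functor.map_comp, Category.assoc,
      Category.assoc]
    congr 1
    refine Cofan.IsColimit.hom_ext (isColimitShift (coproductIsCoproduct Z) n) _ _ fun i => ?_
    have h₁ : (Sigma.ι Z i)⟦n⟧' ≫ (Sigma.desc fun i => φ i ≫ (c.inj i)⟦-n⟧')⟦n⟧' =
        (φ i)⟦n⟧' ≫ (c.inj i)⟦-n⟧'⟦n⟧' := by
      simp [← Functor.map_comp]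
    refine h₁.trans (Eq.trans ?_ (Cofan.IsColimit.fac_assoc
      (isColimitShift (coproductIsCoproduct Z) n) (Sigma.ι fun i => (Z i)⟦n⟧) i _).symm)
    rw [Sigma.ι_desc_assoc]
    rw [shift_neg_shift']
    exact ((Category.assoc _ _ _).trans (Category.assoc _ _ _)).symm
  ext₂ D hD h₁ h₃ := by
    refine factorsThroughFamily_of_sigma fun {I} X _ c hc f => ?_
    obtain ⟨Z₁, φ, g₁, hZ₁, hg₁⟩ := FactorsThroughFamily.exists_sigma h₁ hc (D.mor₁ ≫ f)
    choose W p q hW using fun i => distinguished_cocone_triangle (φ i)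
    let π : c.pt ⟶ ∐ W := Cofan.IsColimit.desc hc (fun i => p i ≫ Sigma.ι W i)
    have hπ : Sigma.desc (fun i => φ i ≫ c.inj i) ≫ π = 0 := by
      refine Sigma.hom_ext _ _ fun i => ?_
      simp [π, reassoc_of% distTriang_comp₁₂ (hW i)]
    obtain ⟨k, hk⟩ := D.yoneda_exact₂ hD (f ≫ π) (by
      rw [reassoc_of% hg₁, hπ, comp_zero])
    obtain ⟨Z₃, ψ, g₃, hZ₃, hg₃⟩ :=
      FactorsThroughFamily.exists_sigma h₃ (coproductIsCoproduct W) k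
    replace hg₃ : k = g₃ ≫ Sigma.desc (fun i => ψ i ≫ Sigma.ι W i) := hg₃
    choose Z a b hZ hD' using fun i => hA.exists_fiber (ψ i ≫ q i) (hZ₁ i) (hZ₃ i)
    choose θ hθ₁ hθ₂ using fun i => distTriang_map₂ (hD' i) (hW i) (ψ i) rfl
    let ρ : ∐ W ⟶ ∐ fun i => (Z₁ i)⟦(1 : ℤ)⟧ := Limits.Sigma.map q
    have hπρ : π ≫ ρ = 0 := by
      refine Cofan.IsColimit.hom_ext hc _ _ fun i => ?_
      simp [π, ρ, reassoc_of% distTriang_comp₂₃ (hW i)]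
    obtain ⟨l, hl⟩ := exists_lift_coproduct (fun i => distTriang_rotate (hD' i))
      (coproductIsCoproduct Z₃) (D.mor₂ ≫ g₃) (by
        have : Cofan.IsColimit.desc (coproductIsCoproduct Z₃)
            (fun i => (ψ i ≫ q i) ≫ Sigma.ι (fun i => (Z₁ i)⟦(1 : ℤ)⟧) i) =
            Sigma.desc (fun i => ψ i ≫ Sigma.ι W i) ≫ ρ :=
          Cofan.IsColimit.hom_ext (coproductIsCoproduct Z₃) _ _ fun i =>
            (Cofan.IsColimit.fac (coproductIsCoproduct Z₃) _ i).trans (by simp [ρ])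
        rw [this, Category.assoc, ← reassoc_of% hg₃, ← reassoc_of% hk, hπρ, comp_zero])
    replace hl : D.mor₂ ≫ g₃ = l ≫ Sigma.desc (fun i => b i ≫ Sigma.ι Z₃ i) := hl
    obtain ⟨m, hm⟩ := exists_lift_coproduct hW hc
      (f - l ≫ Sigma.desc (fun i => θ i ≫ c.inj i)) (by
        rw [Preadditive.sub_comp, sub_eq_zero]
        change f ≫ π = _ ≫ π
        rw [hk, hg₃, reassoc_of% hl, Category.assoc]
        congr 1
        refine Sigma.hom_ext _ _ fun i => ?_
        simp [π, reassoc_of% hθ₂])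
    refine ⟨Z, θ, m ≫ Limits.Sigma.map a + l, hZ, ?_⟩
    rw [sub_eq_iff_eq_add] at hm
    rw [hm, Preadditive.add_comp, Category.assoc]
    congr 2
    refine Sigma.hom_ext _ _ fun i => ?_
    simp [reassoc_of% hθ₁]
  coproduct {K} Y hK hY d hd := by
    refine factorsThroughFamily_of_sigma fun {I} X _ c hc f => ?_
    choose Z φ g hZ hg using
      fun k => FactorsThroughFamily.exists_sigma (hY k) hc (d.inj k ≫ f)
    refine ⟨fun i => ∐ fun k => Z k i, fun i => Sigma.desc fun k => φ k i,
      Cofan.IsColimit.desc hd fun k => g k ≫ Limits.Sigma.map fun i => Sigma.ι (fun k => Z k i) k,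
      fun i => hA.coproduct _ hK (fun k => hZ k i) _ (coproductIsCoproduct _), ?_⟩
    refine Cofan.IsColimit.hom_ext hd _ _ fun k => ?_
    rw [hg, Cofan.IsColimit.fac_assoc, Category.assoc]
    congr 1
    refine Sigma.hom_ext _ _ fun i => ?_
    simp

section Closure

variable (κ : Cardinal.{v})

lemma exists_forall_lt_ord_toType {κ : Cardinal.{v}} (hκ : κ.IsRegular) {K : Type v}
    (hK : Cardinal.mk K < κ) (f : K → κ.ord.ToType) : ∃ b, ∀ k, f k < b := by
  have h : Function.Surjective (fun i => (⟨f i, i, rfl⟩ : Set.range f)) := by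
    rintro ⟨_, i, rfl⟩
    exact ⟨i, rfl⟩
  have := Cardinal.noMaxOrder hκ.aleph0_le
  suffices ∃ b, ∀ k, f k ≤ b by
    obtain ⟨b, hb⟩ := this
    obtain ⟨b', hb'⟩ := exists_gt b
    exact ⟨b', fun k => (hb k).trans_lt hb'⟩
  contrapose! hK
  rw [← hκ.cof_ord, ← Ordinal.cof_toType]
  refine (Order.cof_le fun j => ?_).trans (Cardinal.mk_le_of_surjective h)
  obtain ⟨k, hk⟩ := hK j
  exact ⟨_, Set.mem_range_self k, hk.le⟩

/-- One step in the construction of the `κ`-localizing closure of `S`: add to `S` chosen shifts,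
extensions and small coproducts of objects of `A`. -/
noncomputable def closureStep (S A : Set T) : Set T :=
  S ∪ Set.range (fun p : A × ℤ => (p.1 : T)⟦p.2⟧) ∪
    Set.range (fun p : Σ (X Z : A), ((Z : T) ⟶ (X : T)⟦(1 : ℤ)⟧) =>
      (distinguished_cocone_triangle₂ p.2.2).choose) ∪
    Set.range (fun p : Σ (K : Set κ.ord.ToType), (K → A) => ∐ fun k => (p.2 k : T))

lemma small_closureStep (S A : Set T) [Small.{v} S] [Small.{v} A] :
    Small.{v} (closureStep κ S A) := by
  unfold closureStep
  infer_instance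

/-- The transfinite iteration of `closureStep`. -/
noncomputable def closureStage (S : Set T) (a : κ.ord.ToType) : Set T :=
  closureStep κ S (⋃ b : Set.Iio a, closureStage S b.1)
termination_by a
decreasing_by exact b.2

lemma small_closureStage (S : Set T) [Small.{v} S] (a : κ.ord.ToType) :
    Small.{v} (closureStage κ S a) := by
  induction a using WellFoundedLT.induction with
  | ind a ih =>
    rw [closureStage]
    have : ∀ b : Set.Iio a, Small.{v} (closureStage κ S b.1) := fun b => ih b.1 b.2
    exact small_closureStep κ S _

lemma isCardLocalizing_closureStage {κ : Cardinal.{v}} (hκ : κ.IsRegular) (S : Set T) :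
    IsCardLocalizing κ {X | ∃ a, ∃ Y ∈ closureStage κ S a, Nonempty (X ≅ Y)} where
  shift X n := by
    rintro ⟨a, Y, hY, ⟨e⟩⟩
    obtain ⟨b, hb⟩ := exists_forall_lt_ord_toType hκ (K := PUnit) (by simpa using hκ.nat_lt 1)
      (fun _ => a)
    refine ⟨b, Y⟦n⟧, ?_, ⟨(shiftFunctor T n).mapIso e⟩⟩
    rw [closureStage]
    exact Or.inl (Or.inl (Or.inr ⟨(⟨Y, Set.mem_iUnion_of_mem ⟨a, hb ⟨⟩⟩ hY⟩, n), rfl⟩))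
  ext₂ D hD := by
    rintro ⟨a, X, hX, ⟨e⟩⟩ ⟨a', Z, hZ, ⟨e'⟩⟩
    obtain ⟨b, hb⟩ := exists_forall_lt_ord_toType hκ (K := ULift Bool)
      (by simpa using hκ.nat_lt 2) (fun i => bif i.down then a else a')
    let h : Z ⟶ X⟦(1 : ℤ)⟧ := e'.inv ≫ D.mor₃ ≫ e.hom⟦1⟧'
    obtain ⟨f, g, hE⟩ := (distinguished_cocone_triangle₂ h).choose_spec
    refine ⟨b, _, ?_, ⟨Triangle.π₂.mapIso (isoTriangleOfIso₁₃ D (Triangle.mk f g h) hD hE e e'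
      (e'.hom_inv_id_assoc _).symm)⟩⟩
    rw [closureStage]
    exact Or.inl (Or.inr ⟨⟨⟨X, Set.mem_iUnion_of_mem ⟨a, hb ⟨true⟩⟩ hX⟩,
      ⟨Z, Set.mem_iUnion_of_mem ⟨a', hb ⟨false⟩⟩ hZ⟩, h⟩, rfl⟩)
  coproduct {I} X hI hX c hc := by
    choose a Y hY e using hX
    obtain ⟨b, hb⟩ := exists_forall_lt_ord_toType hκ hI a
    obtain ⟨j⟩ : Nonempty (I ↪ κ.ord.ToType) := by
      rw [← Cardinal.le_def, Cardinal.mk_ord_toType]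
      exact hI.le
    let r : I ≃ Set.range j := Equiv.ofInjective j j.injective
    refine ⟨b, ∐ fun k : Set.range j => Y (r.symm k), ?_,
      ⟨hc.coconePointUniqueUpToIso (coproductIsCoproduct X) ≪≫
        Sigma.whiskerEquiv r fun i => eqToIso (by simp) ≪≫ (e i).some.symm⟩⟩
    rw [closureStage]
    exact Or.inr ⟨⟨Set.range j, fun k => ⟨Y (r.symm k),
      Set.mem_iUnion_of_mem ⟨a _, hb _⟩ (hY _)⟩⟩, rfl⟩

/-- The `κ`-localizing class generated by a small class is essentially small. -/
lemma exists_small_cardLoc {κ : Cardinal.{v}} (hκ : κ.IsRegular) (S : Set T) [Small.{v} S] :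
    ∃ A : Set T, Small.{v} A ∧ A ⊆ cardLoc κ S ∧
      ∀ X ∈ cardLoc κ S, ∃ Y ∈ A, Nonempty (X ≅ Y) := by
  have hsmall := small_closureStage κ S
  have hS : ∀ a, S ⊆ closureStage κ S a := fun a X hX => by
    rw [closureStage]
    exact Or.inl (Or.inl (Or.inl hX))
  have h := isCardLocalizing_cardLoc κ S
  have : Nonempty κ.ord.ToType := by
    rw [← Cardinal.mk_ne_zero_iff, Cardinal.mk_ord_toType]
    exact hκ.pos.ne'
  have h' := cardLoc_subset (isCardLocalizing_closureStage hκ S) fun X hX =>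
    ⟨Classical.arbitrary _, X, hS _ hX, ⟨Iso.refl X⟩⟩
  refine ⟨(⋃ a, closureStage κ S a) ∩ cardLoc κ S, inferInstance, Set.inter_subset_right,
    fun X hX => ?_⟩
  obtain ⟨a, Y, hY, ⟨e⟩⟩ := h' hX
  exact ⟨Y, ⟨Set.mem_iUnion_of_mem a hY, h.iso hκ e hX⟩, ⟨e⟩⟩

end Closure

section Tower

variable {A : Set T}

omit [HasZeroObject T] [∀ n : ℤ, (shiftFunctor T n).Additive] [Pretriangulated T]
  [HasCoproducts.{v} T] in
lemma shift_eq_zero_of_comp_eq_zero [∀ n : ℤ, (shiftFunctor T n).Additive]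
    (hA : ∀ (X : T) (n : ℤ), X ∈ A → X⟦n⟧ ∈ A) {P Q : T} {g : P ⟶ Q}
    (hg : ∀ Y ∈ A, ∀ f : Y ⟶ P, f ≫ g = 0 → f = 0) {Y : T} (hY : Y ∈ A) (f : Y ⟶ P⟦(1 : ℤ)⟧)
    (hf : f ≫ g⟦(1 : ℤ)⟧' = 0) : f = 0 := by
  obtain ⟨k, hk⟩ := (shiftFunctor T (1 : ℤ)).map_surjective ((shiftNegShift Y 1).hom ≫ f)
  have : k ≫ g = 0 := (shiftFunctor T (1 : ℤ)).map_injective (by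
    rw [Functor.map_comp, hk, Category.assoc, hf, comp_zero, Functor.map_zero])
  rw [hg _ (hA _ _ hY) k this, Functor.map_zero] at hk
  rw [← cancel_epi (shiftNegShift Y (1 : ℤ)).hom, comp_zero]
  exact hk.symm

omit [HasCoproducts.{v} T] in
lemma exists_tower_step {L : Set T} (hL : IsLocalizing T L)
    (hcov : ∀ U : T, ∃ V ∈ L, ∃ π : V ⟶ U, ∀ Y ∈ A, ∀ f : Y ⟶ U, ∃ g, f = g ≫ π)
    {W X : T} (hW : W ∈ L) (a : W ⟶ X) :
    ∃ W' ∈ L, ∃ (t : W ⟶ W') (a' : W' ⟶ X), t ≫ a' = a ∧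
      ∀ Y ∈ A, ∀ u : Y ⟶ W, u ≫ a = 0 → u ≫ t = 0 := by
  obtain ⟨U, i, j, hU⟩ := distinguished_cocone_triangle₁ a
  obtain ⟨V, hV, π, hπ⟩ := hcov U
  obtain ⟨W', t, d, hD⟩ := distinguished_cocone_triangle (π ≫ i)
  obtain ⟨a', ha'⟩ := distTriang_desc₂ hD a (by
    rw [Category.assoc, distTriang_comp₁₂ hU, comp_zero])
  refine ⟨W', (hL.isCardLocalizing Cardinal.aleph0).cofiber hD hV hW, t, a', ha'.symm,
    fun Y hY u hu => ?_⟩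
  obtain ⟨l, rfl⟩ := distTriang_lift₂ hU u hu
  obtain ⟨g, rfl⟩ := hπ Y hY l
  rw [Category.assoc, Category.assoc, ← Category.assoc π, distTriang_comp₁₂ hD, comp_zero]

omit [HasCoproducts.{v} T] in
lemma exists_tower {L : Set T} (hL : IsLocalizing T L)
    (hcov : ∀ U : T, ∃ V ∈ L, ∃ π : V ⟶ U, ∀ Y ∈ A, ∀ f : Y ⟶ U, ∃ g, f = g ≫ π) (X : T) :
    ∃ (W : ℕ → T) (a : ∀ n, W n ⟶ X) (t : ∀ n, W n ⟶ W (n + 1)), (∀ n, W n ∈ L) ∧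
      (∀ n, t n ≫ a (n + 1) = a n) ∧ (∀ n, ∀ Y ∈ A, ∀ f : Y ⟶ X, ∃ g, f = g ≫ a n) ∧
      ∀ n, ∀ Y ∈ A, ∀ u : Y ⟶ W n, u ≫ a n = 0 → u ≫ t n = 0 := by
  choose W' hW' t a' hta hu using
    fun p : {p : Over X // p.left ∈ L} => exists_tower_step hL hcov p.2 p.1.hom
  obtain ⟨V, hV, π, hπ⟩ := hcov X
  let F : ℕ → {p : Over X // p.left ∈ L} :=
    fun n => Nat.rec ⟨Over.mk π, hV⟩ (fun _ p => ⟨Over.mk (a' p), hW' p⟩) n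
  refine ⟨fun n => (F n).1.left, fun n => (F n).1.hom, fun n => t (F n), fun n => (F n).2,
    fun n => hta (F n), fun n => ?_, fun n => hu (F n)⟩
  induction n with
  | zero => exact hπ
  | succ n ih =>
    intro Y hY f
    obtain ⟨g, hg⟩ := ih Y hY f
    exact ⟨g ≫ t (F n), by rw [hg, Category.assoc]; exact congrArg (g ≫ ·) (hta (F n)).symm⟩

/-- The coproduct of the terms of a sequence. -/
noncomputable abbrev seqCoproduct (W : ℕ → T) : T := ∐ fun n : ULift.{v} ℕ => W n.down

/-- The inclusion of the `n`-th term of a sequence in the coproduct. -/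
noncomputable def seqι (W : ℕ → T) (n : ℕ) : W n ⟶ seqCoproduct W :=
  Sigma.ι (fun n : ULift.{v} ℕ => W n.down) ⟨n⟩

/-- The morphism from the coproduct of a sequence with prescribed restrictions. -/
noncomputable def seqDesc {W : ℕ → T} {X : T} (a : ∀ n, W n ⟶ X) : seqCoproduct W ⟶ X :=
  Limits.Sigma.desc fun n => a n.down

omit [HasZeroObject T] [HasShift T ℤ] [Preadditive T] [∀ n : ℤ, (shiftFunctor T n).Additive]
  [Pretriangulated T] in
@[simp]
lemma seqι_desc {W : ℕ → T} {X : T} (a : ∀ n, W n ⟶ X) (n : ℕ) : seqι W n ≫ seqDesc a = a n :=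
  Sigma.ι_desc _ _

omit [HasZeroObject T] [HasShift T ℤ] [Preadditive T] [∀ n : ℤ, (shiftFunctor T n).Additive]
  [Pretriangulated T] in
@[simp]
lemma seqι_desc_assoc {W : ℕ → T} {X Y : T} (a : ∀ n, W n ⟶ X) (n : ℕ) (f : X ⟶ Y) :
    seqι W n ≫ seqDesc a ≫ f = a n ≫ f := by
  rw [← Category.assoc, seqι_desc]

omit [HasZeroObject T] [HasShift T ℤ] [Preadditive T] [∀ n : ℤ, (shiftFunctor T n).Additive]
  [Pretriangulated T] in
lemma seq_hom_ext {W : ℕ → T} {X : T} {f g : seqCoproduct W ⟶ X}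
    (h : ∀ n, seqι W n ≫ f = seqι W n ≫ g) : f = g :=
  Sigma.hom_ext _ _ fun n => h n.down

omit [HasZeroObject T] [HasShift T ℤ] [∀ n : ℤ, (shiftFunctor T n).Additive]
  [Pretriangulated T] in
/-- For a constant sequence, the morphism `1 - shift` is a split monomorphism with cokernel the
fold map. -/
lemma exists_retraction_one_sub_shift (X : T) :
    ∃ r : seqCoproduct (fun _ => X) ⟶ seqCoproduct (fun _ => X),
      (𝟙 _ - seqDesc fun n => seqι (fun _ => X) (n + 1)) ≫ r = 𝟙 _ ∧
      r ≫ (𝟙 _ - seqDesc fun n => seqι (fun _ => X) (n + 1)) =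
        𝟙 _ - (seqDesc fun _ => 𝟙 X) ≫ seqι (fun _ => X) 0 := by
  refine ⟨seqDesc fun n => -∑ k ∈ Finset.range n, seqι (fun _ => X) k, ?_, ?_⟩
  · refine seq_hom_ext fun n => ?_
    simp [Preadditive.comp_sub, Preadditive.sub_comp, Finset.sum_range_succ]
  · refine seq_hom_ext fun n => ?_
    have := Finset.sum_range_sub (fun k => seqι (fun _ => X) k) n
    rw [Finset.sum_sub_distrib, sub_eq_iff_eq_add] at this
    simp only [Preadditive.comp_sub, Preadditive.neg_comp, Preadditive.sum_comp, seqι_desc,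
      seqι_desc_assoc, Category.id_comp, Category.comp_id, this]
    abel

lemma comp_shift_eq_zero (hfac : ∀ Y ∈ A, FactorsThroughFamily T Set.univ A Y)
    {X : T} {W : ℕ → T} {a : ∀ n, W n ⟶ X} {t : ∀ n, W n ⟶ W (n + 1)}
    (ht : ∀ n, ∀ Y ∈ A, ∀ u : Y ⟶ W n, u ≫ a n = 0 → u ≫ t n = 0) {Y : T} (hY : Y ∈ A)
    (y : Y ⟶ seqCoproduct W) (hy : y ≫ (seqDesc fun n => a n ≫ seqι (fun _ => X) n) = 0) :
    y ≫ (seqDesc fun n => t n ≫ seqι W (n + 1)) = 0 := by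
  choose U i j hU using fun n : ULift.{v} ℕ => distinguished_cocone_triangle₁ (a n.down)
  obtain ⟨g, hg⟩ := exists_lift_coproduct hU (coproductIsCoproduct _) y (by
    rw [← hy]
    congr 1
    exact Cofan.IsColimit.hom_ext (coproductIsCoproduct _) _ _ fun n =>
      (Cofan.IsColimit.fac (coproductIsCoproduct _) _ n).trans
        (seqι_desc (fun n => a n ≫ seqι (fun _ => X) n) n.down).symm)
  obtain ⟨Z, φ, k, hZ, hk⟩ :=
    FactorsThroughFamily.exists_sigma (hfac Y hY) (coproductIsCoproduct _) g
  replace hg : y = g ≫ Limits.Sigma.desc fun n => i n ≫ seqι W n.down := hg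
  replace hk : g = k ≫ Limits.Sigma.desc fun n => φ n ≫ Sigma.ι U n := hk
  rw [hg, hk, Category.assoc, Category.assoc]
  convert comp_zero
  refine Sigma.hom_ext _ _ fun n => ?_
  have := ht n.down (Z n) (hZ n) (φ n ≫ i n) (by
    rw [Category.assoc, distTriang_comp₁₂ (hU n), comp_zero])
  simp [reassoc_of% this]

omit [HasZeroObject T] [HasShift T ℤ] [Preadditive T] [∀ n : ℤ, (shiftFunctor T n).Additive]
  [Pretriangulated T] in
lemma exists_lift_constant (hfac : ∀ Y ∈ A, FactorsThroughFamily T Set.univ A Y)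
    {X : T} {W : ℕ → T} {a : ∀ n, W n ⟶ X}
    (ha : ∀ n, ∀ Y ∈ A, ∀ f : Y ⟶ X, ∃ g, f = g ≫ a n) {Y : T} (hY : Y ∈ A)
    (y : Y ⟶ seqCoproduct fun _ => X) :
    ∃ w : Y ⟶ seqCoproduct W, y = w ≫ (seqDesc fun n => a n ≫ seqι (fun _ => X) n) := by
  obtain ⟨Z, φ, k, hZ, rfl⟩ :=
    FactorsThroughFamily.exists_sigma (hfac Y hY) (coproductIsCoproduct _) y
  choose ψ hψ using fun n => ha n.down (Z n) (hZ n) (φ n)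
  refine ⟨k ≫ Limits.Sigma.desc fun n => ψ n ≫ seqι W n.down, ?_⟩
  rw [Category.assoc]
  congr 1
  refine Sigma.hom_ext _ _ fun n => ?_
  rw [Sigma.ι_desc, Sigma.ι_desc_assoc]
  change φ n ≫ seqι (fun _ => X) n.down = _
  simp [hψ]

lemma mem_of_tower (hA : ∀ (X : T) (n : ℤ), X ∈ A → X⟦n⟧ ∈ A)
    (hfac : ∀ Y ∈ A, FactorsThroughFamily T Set.univ A Y)
    (hnd : ∀ X, (∀ Y ∈ A, ∀ f : Y ⟶ X, f = 0) → IsZero X) {L : Set T} (hL : IsLocalizing T L)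
    (hcov : ∀ U : T, ∃ V ∈ L, ∃ π : V ⟶ U, ∀ Y ∈ A, ∀ f : Y ⟶ U, ∃ g, f = g ≫ π) (X : T) :
    X ∈ L := by
  obtain ⟨W, a, t, hW, hta, ha, ht⟩ := exists_tower hL hcov X
  obtain ⟨r, hr₁, hr₂⟩ := exists_retraction_one_sub_shift X
  set σ : seqCoproduct (fun _ => X) ⟶ seqCoproduct (fun _ => X) :=
    seqDesc fun n => seqι (fun _ => X) (n + 1)
  let s : seqCoproduct W ⟶ seqCoproduct W := seqDesc fun n => t n ≫ seqι W (n + 1)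
  let α : seqCoproduct W ⟶ seqCoproduct (fun _ => X) :=
    seqDesc fun n => a n ≫ seqι (fun _ => X) n
  let p : seqCoproduct (fun _ => X) ⟶ X := seqDesc fun _ => 𝟙 X
  have hsα : s ≫ α = α ≫ σ := seq_hom_ext fun n => by simp [s, α, σ, reassoc_of% hta]
  have hσp : σ ≫ p = p := seq_hom_ext fun n => by simp [σ, p]
  have hs : ∀ Y ∈ A, ∀ f : Y ⟶ seqCoproduct W, f ≫ α = 0 → f ≫ s = 0 := fun Y hY f hf =>
    comp_shift_eq_zero hfac ht hY f hf
  have hinj : ∀ Y ∈ A, ∀ f : Y ⟶ seqCoproduct W, f ≫ (𝟙 _ - s) = 0 → f = 0 := by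
    intro Y hY f hf
    rw [Preadditive.comp_sub, Category.comp_id, sub_eq_zero] at hf
    rw [hf]
    apply hs Y hY
    rw [← Category.comp_id (f ≫ α), ← hr₁, ← Category.assoc, Preadditive.comp_sub,
      Category.comp_id, Category.assoc, ← hsα, ← Category.assoc, ← hf, sub_self, zero_comp]
  obtain ⟨H, c, d, hH⟩ := distinguished_cocone_triangle (𝟙 _ - s)
  obtain ⟨b, hb⟩ := distTriang_desc₂ hH (α ≫ p) (by
    rw [Preadditive.sub_comp, ← Category.assoc s, hsα, Category.assoc, hσp, Category.id_comp,
      sub_self])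
  have hbsurj : ∀ Y ∈ A, ∀ f : Y ⟶ X, ∃ g, f = g ≫ b := by
    intro Y hY f
    obtain ⟨g, rfl⟩ := ha 0 Y hY f
    exact ⟨g ≫ seqι W 0 ≫ c, by simp [← hb, α, p]⟩
  have hbinj : ∀ Y ∈ A, ∀ f : Y ⟶ H, f ≫ b = 0 → f = 0 := by
    intro Y hY f hf
    obtain ⟨y, rfl⟩ := distTriang_lift₃ hH f (shift_eq_zero_of_comp_eq_zero hA hinj hY _ (by
      have : d ≫ (𝟙 (seqCoproduct W) - s)⟦(1 : ℤ)⟧' = 0 := comp_distTriang_mor_zero₃₁ _ hH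
      rw [Category.assoc, this, comp_zero]))
    rw [Category.assoc, ← hb, ← Category.assoc] at hf
    obtain ⟨w, hw⟩ := exists_lift_constant hfac ha hY (y ≫ α ≫ r)
    change y ≫ α ≫ r = w ≫ α at hw
    have h₁ : (y - w ≫ (𝟙 _ - s)) ≫ α = 0 := by
      have h₂ : (y ≫ α) ≫ r ≫ (𝟙 _ - σ) = y ≫ α := by
        rw [hr₂, Preadditive.comp_sub, Category.comp_id, ← Category.assoc (y ≫ α), hf, zero_comp,
          sub_zero]
      rw [Category.assoc, reassoc_of% hw] at h₂
      rw [Preadditive.sub_comp, ← h₂]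
      simp [Preadditive.comp_sub, Preadditive.sub_comp, hsα]
    have h₂ := hs Y hY _ h₁
    have h₃ : y = (y - w ≫ (𝟙 _ - s) + w) ≫ (𝟙 _ - s) := by
      rw [Preadditive.add_comp, Preadditive.comp_sub (y - _), h₂, Category.comp_id, sub_zero,
        sub_add_cancel]
    rw [h₃, Category.assoc, distTriang_comp₁₂ hH, comp_zero]
  obtain ⟨C, k, l, hC⟩ := distinguished_cocone_triangle b
  have hC₀ : IsZero C := hnd C fun Y hY f => by
    obtain ⟨g, rfl⟩ := distTriang_lift₃ hC f (shift_eq_zero_of_comp_eq_zero hA hbinj hY _ (by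
      have : l ≫ b⟦(1 : ℤ)⟧' = 0 := comp_distTriang_mor_zero₃₁ _ hC
      rw [Category.assoc, this, comp_zero]))
    obtain ⟨g, rfl⟩ := hbsurj Y hY g
    rw [Category.assoc, distTriang_comp₁₂ hC, comp_zero]
  have : IsIso b := (Triangle.isZero₃_iff_isIso₁ _ hC).1 hC₀
  have hP : seqCoproduct W ∈ L :=
    hL.coproductClosed (fun n : ULift.{v} ℕ => W n.down) (fun n => hW n.down) _
      (coproductIsCoproduct _)
  exact hL.isoClosed (asIso b) ((hL.isCardLocalizing Cardinal.aleph0).cofiber hH hP hP)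

end Tower

section Exhaustion

lemma exists_isRegular_ge {I : Type v} (κ : I → Cardinal.{v}) :
    ∃ μ : Cardinal.{v}, μ.IsRegular ∧ Cardinal.mk I < μ ∧ ∀ i, κ i ≤ μ :=
  ⟨Order.succ (Cardinal.aleph0 + Cardinal.mk I + Cardinal.sum κ),
    Cardinal.isRegular_succ (by rw [add_assoc]; exact self_le_add_right _ _),
    Order.lt_succ_of_le ((self_le_add_left _ _).trans (self_le_add_right _ _)),
    fun i => ((Cardinal.le_sum κ i).trans (self_le_add_left _ _)).trans (Order.le_succ _)⟩

omit [HasCoproducts.{v} T] in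
lemma IsCardLocalizing.zero_mem {κ : Cardinal.{v}} {A : Set T} (hA : IsCardLocalizing κ A)
    (hκ : κ.IsRegular) {X : T} (hX : IsZero X) : X ∈ A :=
  hA.coproduct (fun _ : PEmpty.{v + 1} => X) (by simpa using hκ.pos) (fun i => i.elim)
    (Cofan.mk X fun i => i.elim)
    (Cofan.IsColimit.mk _ (fun _ => 0) (fun _ j => j.elim) (fun _ _ _ => hX.eq_of_src _ _))

omit [HasCoproducts.{v} T] in
lemma isLocalizing_iUnion_cardLoc (κ₀ : Cardinal.{v}) (G : Set T) :
    IsLocalizing T {X | ∃ κ, κ.IsRegular ∧ κ₀ ≤ κ ∧ X ∈ cardLoc κ G} where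
  zero := by
    obtain ⟨μ, hμ, -, h⟩ := exists_isRegular_ge fun _ : PUnit => κ₀
    exact ⟨μ, hμ, h ⟨⟩, (isCardLocalizing_cardLoc μ G).zero_mem hμ (isZero_zero T)⟩
  isoClosed e := by
    rintro ⟨κ, hκ, h, hX⟩
    exact ⟨κ, hκ, h, (isCardLocalizing_cardLoc κ G).iso hκ e hX⟩
  shiftClosed X n := by
    rintro ⟨κ, hκ, h, hX⟩
    exact ⟨κ, hκ, h, (isCardLocalizing_cardLoc κ G).shift X n hX⟩
  ext₂ D hD := by
    rintro ⟨κ, hκ, h, hX⟩ ⟨κ', hκ', h', hX'⟩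
    rcases le_total κ κ' with hle | hle
    · exact ⟨κ', hκ', h', (isCardLocalizing_cardLoc κ' G).ext₂ D hD (cardLoc_mono hle G hX) hX'⟩
    · exact ⟨κ, hκ, h, (isCardLocalizing_cardLoc κ G).ext₂ D hD hX (cardLoc_mono hle G hX')⟩
  coproductClosed {I} X hX c hc := by
    choose κ hκ h hX using hX
    obtain ⟨μ, hμ, hI, hle⟩ := exists_isRegular_ge fun i : Option I => i.elim κ₀ κ
    exact ⟨μ, hμ, hle none, (isCardLocalizing_cardLoc μ G).coproduct X
      ((Cardinal.mk_le_of_injective (Option.some_injective I)).trans_lt hI)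
      (fun i => cardLoc_mono (hle (some i)) G (hX i)) c hc⟩

omit [∀ n : ℤ, (shiftFunctor T n).Additive] [Pretriangulated T] [HasZeroObject T]
  [HasShift T ℤ] [Preadditive T] in
lemma exists_weak_cover (A : Set T) [Small.{v} A] (U : T) :
    ∃ (I : Type v) (V : I → T) (π : ∐ V ⟶ U), (∀ i, V i ∈ A) ∧
      ∀ Y ∈ A, ∀ f : Y ⟶ U, ∃ g, f = g ≫ π := by
  let e := equivShrink (Σ Y : A, ((Y : T) ⟶ U))
  refine ⟨Shrink (Σ Y : A, ((Y : T) ⟶ U)), fun i => (e.symm i).1,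
    Limits.Sigma.desc fun i => (e.symm i).2, fun i => (e.symm i).1.2, fun Y hY f => ?_⟩
  have key : ∀ p : Σ Y : A, ((Y : T) ⟶ U), ∀ i, e.symm i = p →
      ∃ g : (p.1 : T) ⟶ ∐ fun i => ((e.symm i).1 : T),
        p.2 = g ≫ Limits.Sigma.desc fun i => (e.symm i).2 := by
    rintro _ i rfl
    exact ⟨Sigma.ι (fun i => ((e.symm i).1 : T)) i, by simp⟩
  exact key ⟨⟨Y, hY⟩, f⟩ _ (e.symm_apply_apply _)

variable {κ₀ κ : Cardinal.{v}} {G : Set T}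

omit [HasCoproducts.{v} T] in
lemma cardLoc_subset_isCutSmall (hG : GeneratesWell T Set.univ κ₀ G) (hκ : κ.IsRegular)
    (h : κ₀ ≤ κ) : cardLoc κ G ⊆ {Y | IsCutSmall κ Y} :=
  cardLoc_subset (isCardLocalizing_isCutSmall hκ) fun Y hY I X c hc f => by
    obtain ⟨J, hJ, hf⟩ := IsKappaSmall.isCutSmall (hG.kappaSmall Y hY) X c hc f
    exact ⟨J, hJ.trans_le h, hf⟩

lemma cardLoc_subset_factorsThroughFamily (hG : GeneratesWell T Set.univ κ₀ G) :
    cardLoc κ G ⊆ {Y | FactorsThroughFamily T Set.univ (cardLoc κ G) Y} :=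
  cardLoc_subset (isCardLocalizing_factorsThroughFamily (isCardLocalizing_cardLoc κ G))
    fun Y hY I X hX c hc f => by
      obtain ⟨Z, hZ, h⟩ := hG.factors Y hY X hX c hc f
      exact ⟨Z, fun i => subset_cardLoc κ G (hZ i), h⟩

lemma exists_mem_cardLoc (hκ₀ : κ₀.IsRegular) (hG : GeneratesWell T Set.univ κ₀ G) (X : T) :
    ∃ κ, κ.IsRegular ∧ κ₀ ≤ κ ∧ X ∈ cardLoc κ G := by
  have := hG.isSmall
  have hA := isCardLocalizing_cardLoc κ₀ G
  have hL := isLocalizing_iUnion_cardLoc κ₀ G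
  obtain ⟨A, _, hAG, hAr⟩ := exists_small_cardLoc hκ₀ G
  refine mem_of_tower (A := cardLoc κ₀ G) hA.shift (cardLoc_subset_factorsThroughFamily hG)
    (fun X hX => hG.nondegenerate X trivial fun Y hY => hX Y (subset_cardLoc κ₀ G hY)) hL
    (fun U => ?_) X
  obtain ⟨I, V, π, hV, hπ⟩ := exists_weak_cover A U
  refine ⟨∐ V, hL.coproductClosed V (fun i => ⟨κ₀, hκ₀, le_rfl, hAG (hV i)⟩) _
    (coproductIsCoproduct V), π, fun Y hY f => ?_⟩
  obtain ⟨Y', hY', ⟨e⟩⟩ := hAr Y hY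
  obtain ⟨g, hg⟩ := hπ Y' hY' (e.inv ≫ f)
  exact ⟨e.hom ≫ g, by rw [Category.assoc, ← hg, e.hom_inv_id_assoc]⟩

lemma exists_subset_cardLoc (hκ₀ : κ₀.IsRegular) (hG : GeneratesWell T Set.univ κ₀ G)
    (S : Set T) [Small.{v} S] : ∃ κ, κ.IsRegular ∧ κ₀ ≤ κ ∧ S ⊆ cardLoc κ G := by
  choose κ hκ h hX using exists_mem_cardLoc hκ₀ hG
  obtain ⟨μ, hμ, -, hle⟩ := exists_isRegular_ge fun i : Option (Shrink.{v} S) =>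
    i.elim κ₀ fun i => κ ((equivShrink S).symm i)
  refine ⟨μ, hμ, hle none, fun X hXS => cardLoc_mono ?_ G (hX X)⟩
  simpa using hle (some (equivShrink S ⟨X, hXS⟩))

end Exhaustion

/-- If every morphism from `A` to an object factors through `B`, the same holds for the objects
of the localizing subcategory generated by such objects. -/
lemma isLocalizing_factorsThrough {κ : Cardinal.{v}} (hκ : κ.IsRegular) {A B : Set T}
    (hA : IsCardLocalizing κ A) (hB : IsCardLocalizing κ B) (hBA : B ⊆ A)
    (hsmall : ∀ Y ∈ A, IsCutSmall κ Y) (hfac : ∀ Y ∈ A, FactorsThroughFamily T Set.univ A Y) :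
    IsLocalizing T {X | ∀ C ∈ A, ∀ f : C ⟶ X, ∃ Z ∈ B, ∃ (g : C ⟶ Z) (h : Z ⟶ X), f = g ≫ h} := by
  have hshift : ∀ (X : T) (n : ℤ),
      (∀ C ∈ A, ∀ f : C ⟶ X, ∃ Z ∈ B, ∃ (g : C ⟶ Z) (h : Z ⟶ X), f = g ≫ h) →
      ∀ C ∈ A, ∀ f : C ⟶ X⟦n⟧, ∃ Z ∈ B, ∃ (g : C ⟶ Z) (h : Z ⟶ X⟦n⟧), f = g ≫ h := by
    intro X n hX C hC f
    obtain ⟨f', hf'⟩ := (shiftFunctor T n).map_surjective ((shiftNegShift C n).hom ≫ f)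
    obtain ⟨Z, hZ, g, h, rfl⟩ := hX _ (hA.shift C (-n) hC) f'
    refine ⟨Z⟦n⟧, hB.shift Z n hZ, (shiftNegShift C n).inv ≫ g⟦n⟧', h⟦n⟧', ?_⟩
    rw [Category.assoc, ← Functor.map_comp, hf', Iso.inv_hom_id_assoc]
  refine ⟨fun C _ f => ⟨_, hB.zero_mem hκ (isZero_zero T), 0, 0, (isZero_zero T).eq_of_tgt _ _⟩,
    fun e hX C hC f => ?_, hshift, fun D hD h₁ h₃ C hC f => ?_, fun {I} X hX c hc C hC f => ?_⟩
  · obtain ⟨Z, hZ, g, h, hf⟩ := hX C hC (f ≫ e.inv)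
    exact ⟨Z, hZ, g, h ≫ e.hom, by rw [← Category.assoc, ← hf, Category.assoc, e.inv_hom_id,
      Category.comp_id]⟩
  · obtain ⟨Y, hY, g, h, hgh⟩ := h₃ C hC (f ≫ D.mor₂)
    obtain ⟨D', k, d, hD'⟩ := distinguished_cocone_triangle g
    obtain ⟨l, hl⟩ := distTriang_desc₂ hD' (h ≫ D.mor₃) (by
      rw [← Category.assoc, ← hgh, Category.assoc, comp_distTriang_mor_zero₂₃ _ hD, comp_zero])
    obtain ⟨W, hW, p, q, rfl⟩ := hshift _ 1 h₁ D' (hA.cofiber hD' hC (hBA hY)) l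
    obtain ⟨Y', i, j, hY'⟩ := distinguished_cocone_triangle₁ (k ≫ p)
    obtain ⟨g', hg'⟩ := distTriang_lift₂ hY' g (by
      rw [← Category.assoc, distTriang_comp₁₂ hD', zero_comp])
    obtain ⟨e, he⟩ := D.coyoneda_exact₃ hD (i ≫ h) (by
      rw [Category.assoc, hl, ← Category.assoc k, ← Category.assoc, distTriang_comp₁₂ hY',
        zero_comp])
    obtain ⟨x, hx⟩ := D.coyoneda_exact₂ hD (f - g' ≫ e) (by
      rw [Preadditive.sub_comp, hgh, hg', Category.assoc, Category.assoc, he, sub_self])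
    obtain ⟨Z, hZ, x₁, x₂, rfl⟩ := h₁ C hC x
    refine ⟨Y' ⊞ Z, hB.biprod_mem (hB.fiber hY' hY hW) hZ, biprod.lift g' x₁,
      biprod.desc e (x₂ ≫ D.mor₁), ?_⟩
    rw [biprod.lift_desc, ← Category.assoc, ← hx, add_sub_cancel]
  · classical
    obtain ⟨J, hJ, hf⟩ := hsmall C hC X c hc f
    obtain ⟨Z, φ, g, hZ, hg⟩ := FactorsThroughFamily.exists_sigma (hfac C hC) hc f
    choose V hV p q hpq using fun i => hX i (Z i) (hZ i) (φ i)
    refine ⟨∐ fun j : J => V j, hB.coproduct _ hJ (fun j => hV j) _ (coproductIsCoproduct _),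
      g ≫ Limits.Sigma.desc fun i =>
        if h : i ∈ J then p i ≫ Sigma.ι (fun j : J => V j) ⟨i, h⟩ else 0,
      Limits.Sigma.desc fun j => q j ≫ c.inj j, ?_⟩
    rw [← hf, hg, Category.assoc, Category.assoc]
    congr 1
    refine Sigma.hom_ext _ _ fun i => ?_
    by_cases hi : i ∈ J
    · simp [hi, inj_cut_of_mem hc hi, hpq]
    · simp [hi, inj_cut_of_notMem hc hi]

end Coproducts

end CardLocalizing

/-- Krause, Thm 7.2.1: if `T` is a well generated triangulated category and
`S` is a set of objects, then the localizing subcategory `Loc S` generated by `S` is well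
generated as well. -/
theorem loc_wellGenerated_of_wellGenerated
    (T : Type u) [Category.{v} T] [HasZeroObject T] [HasShift T ℤ] [Preadditive T]
    [∀ n : ℤ, (shiftFunctor T n).Additive] [Pretriangulated T] [HasCoproducts.{v} T]
    (hT : IsWellGenerated T) (S : Set T) (hS : Small.{v} ↥S) :
    IsWellGeneratedSubcat T (Loc T S) := by
  obtain ⟨κ₀, hκ₀, G, hG⟩ := hT
  obtain ⟨κ, hκ, hle, hSG⟩ := exists_subset_cardLoc hκ₀ hG S
  have hA := isCardLocalizing_cardLoc κ G
  have hB := isCardLocalizing_cardLoc κ S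
  have hBA : cardLoc κ S ⊆ cardLoc κ G := cardLoc_subset hA hSG
  have hsmall := cardLoc_subset_isCutSmall hG hκ hle
  have hfac := cardLoc_subset_factorsThroughFamily (κ := κ) hG
  have key := loc_subset (S := S) (isLocalizing_factorsThrough hκ hA hB hBA hsmall hfac)
    fun X hX C _ f => ⟨X, subset_cardLoc κ S hX, f, 𝟙 X, (Category.comp_id f).symm⟩
  obtain ⟨R, hR, hRS, hRr⟩ := exists_small_cardLoc hκ S
  have key' : ∀ X ∈ Loc T S, ∀ C ∈ cardLoc κ G, ∀ f : C ⟶ X,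
      ∃ Z ∈ R, ∃ (g : C ⟶ Z) (h : Z ⟶ X), f = g ≫ h := by
    intro X hX C hC f
    obtain ⟨Z, hZ, g, h, rfl⟩ := key hX C hC f
    obtain ⟨Z', hZ', ⟨e⟩⟩ := hRr Z hZ
    exact ⟨Z', hZ', g ≫ e.hom, e.inv ≫ h, by simp⟩
  refine ⟨κ, hκ, R, hRS.trans (cardLoc_subset_loc κ S), hR, fun X hX h => ?_,
    fun Y hY => IsCutSmall.isKappaSmall (hsmall (hBA (hRS hY))) _, fun Y hY => ?_⟩
  · refine hG.nondegenerate X trivial fun Y hY f => ?_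
    obtain ⟨Z, hZ, g, k, rfl⟩ := key' X hX Y (subset_cardLoc κ G hY) f
    rw [h Z hZ k, comp_zero]
  · refine factorsThroughFamily_of_sigma fun {I} X hX c hc f => ?_
    obtain ⟨Z, φ, g, hZ, rfl⟩ :=
      FactorsThroughFamily.exists_sigma (hfac (hBA (hRS hY))) hc f
    choose V hV p q hpq using fun i => key' (X i) (hX i) (Z i) (hZ i) (φ i)
    refine ⟨V, q, g ≫ Limits.Sigma.map p, hV, ?_⟩
    rw [Category.assoc]
    congr 1
    refine Sigma.hom_ext _ _ fun i => ?_
    simp [hpq]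

end LocWellGen
end
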